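/- arXiv:2003.05421 — 3 statements merged into one kernel-verified Lean document; each statement's English description precedes it below -/
import Mathlib

section
/- If a sequence (x_n) on the torus exhibits Poissonian correlation of 2k-fold differences, i.e. for all s > 0, lim_{N→∞} (1/N^k) #{1 ≤ a_1,...,a_k, b_1,...,b_k ≤ N with multisets {a_j} ≠ {b_j} : ‖Σ_j x_{a_j} - Σ_j x_{b_j}‖ ≤ s/N^k} = 2s, then (x_n) is equidistributed on T. -/
open Filter
open scoped Classical BigOperators

noncomputable section

/-- distance from a real number to the nearest integer (the torus norm). -/
def tdist (y : ℝ) : ℝ := |y - round y|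

/-- number of pairs of tuples `a, b ∈ {1,…,N}^k` with distinct multisets of entries
such that `‖Σ_j x_{a_j} - Σ_j x_{b_j}‖ ≤ ε`. -/
def kfoldCount (x : ℕ → ℝ) (k N : ℕ) (ε : ℝ) : ℕ :=
  (((Fintype.piFinset fun _ : Fin k => Finset.Icc 1 N) ×ˢ
      (Fintype.piFinset fun _ : Fin k => Finset.Icc 1 N)).filter
    (fun p => (↑(List.ofFn p.1) : Multiset ℕ) ≠ ↑(List.ofFn p.2) ∧
      tdist (∑ j, x (p.1 j) - ∑ j, x (p.2 j)) ≤ ε)).card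

/-- equidistribution on the torus. -/
def Equidistributed (x : ℕ → ℝ) : Prop :=
  ∀ a b : ℝ, 0 ≤ a → a ≤ b → b ≤ 1 →
    Tendsto (fun N : ℕ =>
      (((Finset.Icc 1 N).filter
        (fun n => a ≤ Int.fract (x n) ∧ Int.fract (x n) < b)).card : ℝ) / N)
      atTop (nhds (b - a))

section

open MeasureTheory AddCircle

theorem UnitAddCircle.volume_eq_haarAddCircle :
    (volume : Measure UnitAddCircle) = haarAddCircle := by
  rw [AddCircle.volume_eq_smul_haarAddCircle]
  simp

theorem UnitAddCircle.haarAddCircle_closedBall (y : UnitAddCircle) (ρ : ℝ) :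
    (haarAddCircle : Measure UnitAddCircle) (Metric.closedBall y ρ)
      = ENNReal.ofReal (min 1 (2 * ρ)) := by
  rw [← UnitAddCircle.volume_eq_haarAddCircle]
  exact AddCircle.volume_closedBall (T := 1) ρ

theorem tdist_eq_norm (y : ℝ) : tdist y = ‖(y : UnitAddCircle)‖ :=
  UnitAddCircle.norm_eq.symm

/-- Every point of the circle has a real representative realising its norm. -/
theorem UnitAddCircle.exists_coe_eq_abs_eq_norm (y : UnitAddCircle) :
    ∃ r : ℝ, (r : UnitAddCircle) = y ∧ |r| = ‖y‖ := by
  obtain ⟨u, rfl⟩ := QuotientAddGroup.mk_surjective y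
  refine ⟨u - round u, ?_, (UnitAddCircle.norm_eq (x := u)).symm⟩
  have : ((round u : ℝ) : UnitAddCircle) = 0 :=
    (AddCircle.coe_eq_zero_iff 1).2 ⟨round u, by simp⟩
  rw [AddCircle.coe_sub, this, sub_zero]

theorem UnitAddCircle.closedBall_inter_subset {ρ : ℝ} (hρ : ρ < 1 / 4) (r : ℝ) (hr : |r| ≤ 1 / 2) :
    Metric.closedBall (0 : UnitAddCircle) ρ ∩ Metric.closedBall (r : UnitAddCircle) ρ ⊆
      Metric.closedBall ((r / 2 : ℝ) : UnitAddCircle) (ρ - |r| / 2) := by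
  rintro t ⟨h0, h1⟩
  obtain ⟨u, rfl, hu⟩ := UnitAddCircle.exists_coe_eq_abs_eq_norm t
  rw [mem_closedBall_zero_iff, ← hu] at h0
  rw [mem_closedBall_iff_norm, ← AddCircle.coe_sub, UnitAddCircle.norm_eq] at h1
  have hn : round (u - r) = 0 := by
    by_contra hne
    have h2 : (1 : ℝ) ≤ |(round (u - r) : ℝ)| := by
      exact_mod_cast Int.one_le_abs hne
    have h3 : |(round (u - r) : ℝ)| ≤ |u - r - round (u - r)| + |u| + |r| := by
      have := abs_add_three (-(u - r - round (u - r))) u (-r)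
      rw [abs_neg, abs_neg] at this
      rwa [show -(u - r - (round (u - r) : ℝ)) + u + -r = round (u - r) by ring] at this
    linarith
  rw [hn, Int.cast_zero, sub_zero] at h1
  rw [mem_closedBall_iff_norm, ← AddCircle.coe_sub, UnitAddCircle.norm_eq]
  refine (round_le (u - r / 2) 0).trans ?_
  rw [Int.cast_zero, sub_zero]
  rw [abs_le] at *
  rcases abs_cases r with h | h <;> constructor <;> linarith

theorem UnitAddCircle.haarAddCircle_inter_le {ρ : ℝ} (hρ : ρ < 1 / 4) (y z : UnitAddCircle) :
    (haarAddCircle : Measure UnitAddCircle).real (Metric.closedBall y ρ ∩ Metric.closedBall z ρ)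
      ≤ max 0 (2 * ρ - ‖y - z‖) := by
  obtain ⟨r, hr, hn⟩ := UnitAddCircle.exists_coe_eq_abs_eq_norm (z - y)
  have hhalf : |r| ≤ 1 / 2 := by
    rw [hn]; simpa using AddCircle.norm_le_half_period (1 : ℝ) (x := z - y) one_ne_zero
  have hsub : Metric.closedBall y ρ ∩ Metric.closedBall z ρ ⊆
      Metric.closedBall (((r / 2 : ℝ) : UnitAddCircle) + y) (ρ - |r| / 2) := by
    rintro t ⟨h0, h1⟩
    have := UnitAddCircle.closedBall_inter_subset hρ r hhalf (a := t - y)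
      ⟨by simpa [mem_closedBall_iff_norm, -Metric.mem_closedBall] using h0, by
        simpa [mem_closedBall_iff_norm, hr] using h1⟩
    rw [mem_closedBall_iff_norm] at this ⊢
    convert this using 2
    abel
  rw [norm_sub_rev, ← hn]
  refine (measureReal_mono hsub).trans ?_
  rw [measureReal_def, UnitAddCircle.haarAddCircle_closedBall, ENNReal.toReal_ofReal']
  rw [max_comm]
  exact max_le_max le_rfl ((min_le_right _ _).trans (by linarith))

theorem sq_norm_fourierCoeff_add_le {f : UnitAddCircle → ℂ} (hf : MemLp f 2 haarAddCircle)
    {m : ℤ} (hm : m ≠ 0) :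
    ‖fourierCoeff f 0‖ ^ 2 + ‖fourierCoeff f m‖ ^ 2 ≤ ∫ t, ‖f t‖ ^ 2 ∂haarAddCircle := by
  have h := sum_le_hasSum {0, m} (fun _ _ => by positivity)
    (hasSum_sq_fourierCoeff (hf.toLp f))
  rw [Finset.sum_pair hm.symm] at h
  have e : ∀ i, fourierCoeff (hf.toLp f) i = fourierCoeff f i := fun i =>
    congrFun (fourierCoeff_congr_ae hf.coeFn_toLp) i
  rw [e, e] at h
  refine h.trans_eq (integral_congr_ae ?_)
  filter_upwards [hf.coeFn_toLp] with t ht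
  rw [ht]

theorem fourierCoeff_indicator_closedBall (y : UnitAddCircle) (ρ : ℝ) (n : ℤ) :
    fourierCoeff ((Metric.closedBall y ρ).indicator (1 : UnitAddCircle → ℂ)) n =
      fourier (-n) y *
        fourierCoeff ((Metric.closedBall 0 ρ).indicator (1 : UnitAddCircle → ℂ)) n := by
  unfold fourierCoeff
  rw [← integral_const_mul, ← integral_add_right_eq_self _ y]
  refine integral_congr_ae (Eventually.of_forall fun t => ?_)
  have : t + y ∈ Metric.closedBall y ρ ↔ t ∈ Metric.closedBall 0 ρ := by
    simp
  simp only [Set.indicator, this, smul_eq_mul, Pi.one_apply]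
  have h2 : fourier (-n) (t + y) = fourier (-n) t * (fourier (-n) y : ℂ) := by
    simp only [fourier_apply, smul_add, toCircle_add, Circle.coe_mul]
  rw [h2]
  ring

theorem integrable_fourier (n : ℤ) :
    Integrable (fun t : UnitAddCircle => (fourier n t : ℂ)) haarAddCircle :=
  (fourier n).continuous.integrable_of_hasCompactSupport (HasCompactSupport.of_compactSpace _)

theorem exists_le_norm_fourierCoeff_indicator_closedBall (m : ℤ) :
    ∃ ρ₀ : ℝ, 0 < ρ₀ ∧ ∀ ρ : ℝ, 0 < ρ → ρ < ρ₀ →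
      ρ ≤ ‖fourierCoeff ((Metric.closedBall 0 ρ).indicator (1 : UnitAddCircle → ℂ)) m‖ := by
  have hc : ContinuousAt (fun t : UnitAddCircle => (fourier (-m) t : ℂ)) 0 :=
    (fourier (-m)).continuous.continuousAt
  obtain ⟨r, hr, hball⟩ := Metric.continuousAt_iff.1 hc (1 / 2) (by norm_num)
  refine ⟨min r (1 / 2), by positivity, fun ρ h0 hρ => ?_⟩
  have hρr := hρ.trans_le (min_le_left _ _)
  have hρh := hρ.trans_le (min_le_right _ _)
  set B : Set UnitAddCircle := Metric.closedBall 0 ρ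
  have hB : (haarAddCircle : Measure UnitAddCircle).real B = 2 * ρ := by
    rw [measureReal_def, UnitAddCircle.haarAddCircle_closedBall, ENNReal.toReal_ofReal,
      min_eq_right (by linarith)]
    rw [min_eq_right (by linarith)]; positivity
  have hBm : MeasurableSet B := Metric.isClosed_closedBall.measurableSet
  have e : fourierCoeff (B.indicator (1 : UnitAddCircle → ℂ)) m
      = ∫ t in B, (fourier (-m) t : ℂ) ∂haarAddCircle := by
    rw [fourierCoeff, ← integral_indicator hBm]
    refine integral_congr_ae (Eventually.of_forall fun t => ?_)
    by_cases ht : t ∈ B <;> simp [ht]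
  have hdiff : ‖(∫ t in B, ((fourier (-m) t : ℂ) - 1) ∂haarAddCircle)‖ ≤ 1 / 2 * (2 * ρ) := by
    rw [← hB]
    refine norm_setIntegral_le_of_norm_le_const (measure_lt_top _ _) fun t ht => ?_
    have := hball (x := t) ((Metric.mem_closedBall.1 ht).trans_lt hρr)
    rw [fourier_eval_zero, dist_eq_norm] at this
    exact this.le
  rw [integral_sub (integrable_fourier _).integrableOn (integrable_const _).integrableOn, ← e,
    setIntegral_const, hB] at hdiff
  have h3 : ‖((2 * ρ) • (1 : ℂ))‖ = 2 * ρ := by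
    rw [norm_smul]; simp [abs_of_pos h0]
  have := norm_sub_norm_le ((2 * ρ) • (1 : ℂ))
    (fourierCoeff (B.indicator (1 : UnitAddCircle → ℂ)) m)
  rw [norm_sub_rev] at this
  linarith

theorem integral_sq_sum_indicator_le {ι : Type*} (s : Finset ι) (y : ι → UnitAddCircle)
    {ρ : ℝ} (hρ : ρ < 1 / 4) :
    ∫ t, ‖∑ a ∈ s, (Metric.closedBall (y a) ρ).indicator (1 : UnitAddCircle → ℂ) t‖ ^ 2
        ∂haarAddCircle ≤ ∑ a ∈ s, ∑ b ∈ s, max 0 (2 * ρ - ‖y a - y b‖) := by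
  have e : ∀ t : UnitAddCircle,
      ‖∑ a ∈ s, (Metric.closedBall (y a) ρ).indicator (1 : UnitAddCircle → ℂ) t‖ ^ 2 =
      ∑ a ∈ s, ∑ b ∈ s, (Metric.closedBall (y a) ρ ∩ Metric.closedBall (y b) ρ).indicator
        (1 : UnitAddCircle → ℝ) t := by
    intro t
    have h1 : ∑ a ∈ s, (Metric.closedBall (y a) ρ).indicator (1 : UnitAddCircle → ℂ) t =
        ((∑ a ∈ s, (Metric.closedBall (y a) ρ).indicator (1 : UnitAddCircle → ℝ) t : ℝ) : ℂ) := by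
      push_cast
      refine Finset.sum_congr rfl fun a _ => ?_
      by_cases ht : t ∈ Metric.closedBall (y a) ρ <;> simp [Set.indicator, ht]
    rw [h1, Complex.norm_real, Real.norm_eq_abs, sq_abs, sq, Finset.sum_mul_sum]
    refine Finset.sum_congr rfl fun a _ => Finset.sum_congr rfl fun b _ => ?_
    rw [Set.inter_indicator_one]
    rfl
  have hm : ∀ a b, MeasurableSet (Metric.closedBall (y a) ρ ∩ Metric.closedBall (y b) ρ) :=
    fun a b => (Metric.isClosed_closedBall.inter Metric.isClosed_closedBall).measurableSet
  have hi : ∀ a b, Integrable ((Metric.closedBall (y a) ρ ∩ Metric.closedBall (y b) ρ).indicator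
        (1 : UnitAddCircle → ℝ)) haarAddCircle := fun a b =>
    (integrable_const (1 : ℝ)).indicator (hm a b)
  simp_rw [e]
  rw [integral_finsetSum _ fun a _ => integrable_finsetSum _ fun b _ => hi a b]
  refine Finset.sum_le_sum fun a _ => ?_
  rw [integral_finsetSum _ fun b _ => hi a b]
  refine Finset.sum_le_sum fun b _ => ?_
  rw [integral_indicator_one (hm a b)]
  exact UnitAddCircle.haarAddCircle_inter_le hρ _ _

/-- A lower bound for the triangle-weighted pair correlation of a finite family of points
on the circle by its Weyl sums. -/
theorem exists_sq_norm_sum_fourier_le {m : ℤ} (hm : m ≠ 0) :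
    ∃ ρ₀ : ℝ, 0 < ρ₀ ∧ ∀ ρ : ℝ, 0 < ρ → ρ < ρ₀ →
      ∀ {ι : Type} (s : Finset ι) (y : ι → UnitAddCircle),
        ρ ^ 2 * (4 * (s.card : ℝ) ^ 2 + ‖∑ a ∈ s, (fourier m (y a) : ℂ)‖ ^ 2) ≤
          ∑ a ∈ s, ∑ b ∈ s, max 0 (2 * ρ - ‖y a - y b‖) := by
  obtain ⟨r, hr, h⟩ := exists_le_norm_fourierCoeff_indicator_closedBall m
  refine ⟨min r (1 / 4), by positivity, fun ρ h0 hρ ι s y => ?_⟩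
  have hρr := hρ.trans_le (min_le_left _ _)
  have hρh := hρ.trans_le (min_le_right _ _)
  refine le_trans ?_ (integral_sq_sum_indicator_le s y hρh)
  have hL : ∀ a, MemLp ((Metric.closedBall (y a) ρ).indicator (1 : UnitAddCircle → ℂ)) 2
      haarAddCircle := fun a =>
    (memLp_const (1 : ℂ)).indicator Metric.isClosed_closedBall.measurableSet
  have hcoef : ∀ n : ℤ, fourierCoeff (fun t => ∑ a ∈ s,
      (Metric.closedBall (y a) ρ).indicator (1 : UnitAddCircle → ℂ) t) n =
      (∑ a ∈ s, fourier (-n) (y a)) *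
        fourierCoeff ((Metric.closedBall 0 ρ).indicator (1 : UnitAddCircle → ℂ)) n := by
    intro n
    have h2 := fourierCoeff.sum s (fun a =>
      (Metric.closedBall (y a) ρ).indicator (1 : UnitAddCircle → ℂ))
      (fun a _ => (hL a).integrable one_le_two)
    have h3 := congrFun h2 n
    rw [Finset.sum_apply] at h3
    rw [Finset.sum_mul]
    simp_rw [← fourierCoeff_indicator_closedBall]
    rw [← h3]
    congr 1
    ext t
    simp
  have hb := sq_norm_fourierCoeff_add_le (memLp_finsetSum s fun a _ => hL a) hm
  rw [hcoef, hcoef, norm_mul, norm_mul] at hb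
  refine le_trans ?_ hb
  have e0 : ‖∑ a ∈ s, (fourier (-0) (y a) : ℂ)‖ = s.card := by simp
  have em : ‖∑ a ∈ s, (fourier (-m) (y a) : ℂ)‖ = ‖∑ a ∈ s, (fourier m (y a) : ℂ)‖ := by
    simp_rw [fourier_neg]
    rw [← map_sum, RCLike.norm_conj]
  have ez : ‖fourierCoeff ((Metric.closedBall 0 ρ).indicator (1 : UnitAddCircle → ℂ)) 0‖
      = 2 * ρ := by
    have : fourierCoeff ((Metric.closedBall 0 ρ).indicator (1 : UnitAddCircle → ℂ)) 0 =
        ((haarAddCircle : Measure UnitAddCircle).real (Metric.closedBall 0 ρ) : ℂ) := by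
      rw [fourierCoeff]
      simp only [neg_zero, fourier_zero, one_smul]
      rw [integral_indicator Metric.isClosed_closedBall.measurableSet]
      simp
    rw [this, measureReal_def, UnitAddCircle.haarAddCircle_closedBall,
      ENNReal.toReal_ofReal (by rw [min_eq_right (by linarith)]; positivity),
      min_eq_right (by linarith), Complex.norm_real, Real.norm_eq_abs, abs_of_pos (by positivity)]
  rw [e0, em, ez, mul_pow, mul_pow]
  have := pow_le_pow_left₀ h0.le (h ρ h0 hρr) 2
  nlinarith [sq_nonneg ‖∑ a ∈ s, (fourier m (y a) : ℂ)‖]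

theorem max_zero_sub_le_sum_ite {t M : ℝ} (ht : 0 ≤ t) (hM : 0 < M) (L : ℕ) :
    max 0 (L / M - t) ≤ (1 / M) * ∑ l ∈ Finset.Icc 1 L, if t ≤ l / M then (1 : ℝ) else 0 := by
  have hu : 0 ≤ M * t := by positivity
  refine max_le (mul_nonneg (by positivity)
    (Finset.sum_nonneg fun l _ => by split_ifs <;> norm_num)) ?_
  have hsub : Finset.Ioc ⌊M * t⌋₊ L ⊆ (Finset.Icc 1 L).filter (fun l : ℕ => t ≤ l / M) := by
    intro l hl
    rw [Finset.mem_Ioc] at hl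
    rw [Finset.mem_filter, Finset.mem_Icc]
    refine ⟨⟨by omega, hl.2⟩, ?_⟩
    rw [le_div_iff₀ hM, mul_comm]
    exact ((Nat.floor_lt hu).1 hl.1).le
  have hcard : (L : ℝ) - M * t ≤ ((Finset.Icc 1 L).filter (fun l : ℕ => t ≤ l / M)).card := by
    have h1 : ((Finset.Ioc ⌊M * t⌋₊ L).card : ℝ) ≤ _ :=
      Nat.cast_le.2 (Finset.card_le_card hsub)
    rw [Nat.card_Ioc] at h1
    have h2 : (L : ℝ) ≤ ((L - ⌊M * t⌋₊ : ℕ) : ℝ) + ⌊M * t⌋₊ := by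
      norm_cast
      omega
    linarith [Nat.floor_le hu]
  rw [Finset.sum_boole]
  calc (L : ℝ) / M - t = (1 / M) * (L - M * t) := by field_simp
    _ ≤ _ := by gcongr

theorem card_filter_coe_ofFn_eq_le (k N : ℕ) :
    (((Fintype.piFinset fun _ : Fin k => Finset.Icc 1 N) ×ˢ
      (Fintype.piFinset fun _ : Fin k => Finset.Icc 1 N)).filter
    (fun p => (↑(List.ofFn p.1) : Multiset ℕ) = ↑(List.ofFn p.2))).card ≤ k ^ k * N ^ k := by
  have hsub : ((Fintype.piFinset fun _ : Fin k => Finset.Icc 1 N) ×ˢ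
      (Fintype.piFinset fun _ : Fin k => Finset.Icc 1 N)).filter
      (fun p => (↑(List.ofFn p.1) : Multiset ℕ) = ↑(List.ofFn p.2)) ⊆
      ((Finset.univ : Finset (Fin k → Fin k)) ×ˢ
        (Fintype.piFinset fun _ : Fin k => Finset.Icc 1 N)).image
        (fun q => (q.2, q.2 ∘ q.1)) := by
    rintro ⟨a, b⟩ hp
    rw [Finset.mem_filter, Finset.mem_product] at hp
    obtain ⟨⟨ha, -⟩, he⟩ := hp
    have : ∀ j, ∃ i, a i = b j := by
      intro j
      have hb : b j ∈ (↑(List.ofFn b) : Multiset ℕ) := by simp [List.mem_ofFn]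
      rw [← he] at hb
      simpa [List.mem_ofFn] using hb
    choose f hf using this
    rw [Finset.mem_image]
    exact ⟨(f, a), by simpa using ha, Prod.ext rfl (funext hf)⟩
  refine (Finset.card_le_card hsub).trans (Finset.card_image_le.trans ?_)
  simp

theorem sum_ite_tdist_le (x : ℕ → ℝ) (k N : ℕ) (ε : ℝ) :
    ∑ a ∈ Fintype.piFinset (fun _ : Fin k => Finset.Icc 1 N),
      ∑ b ∈ Fintype.piFinset (fun _ : Fin k => Finset.Icc 1 N),
        (if tdist (∑ j, x (a j) - ∑ j, x (b j)) ≤ ε then (1 : ℝ) else 0) ≤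
      kfoldCount x k N ε + k ^ k * (N : ℝ) ^ k := by
  rw [← Finset.sum_product', Finset.sum_boole]
  norm_cast
  refine le_trans ?_ (Nat.add_le_add_left (card_filter_coe_ofFn_eq_le k N) _)
  refine (Finset.card_le_card ?_).trans (Finset.card_union_le _ _)
  intro p hp
  rw [Finset.mem_filter] at hp
  rw [Finset.mem_union, Finset.mem_filter, Finset.mem_filter]
  by_cases he : (↑(List.ofFn p.1) : Multiset ℕ) = ↑(List.ofFn p.2)
  · exact Or.inr ⟨hp.1, he⟩
  · exact Or.inl ⟨hp.1, he, hp.2⟩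

theorem sum_piFinset_fourier_eq_pow (x : ℕ → ℝ) (k N : ℕ) (m : ℤ) :
    ∑ a ∈ Fintype.piFinset (fun _ : Fin k => Finset.Icc 1 N),
      (fourier m ((∑ j, x (a j) : ℝ) : UnitAddCircle) : ℂ) =
      (∑ n ∈ Finset.Icc 1 N, (fourier m (x n : UnitAddCircle) : ℂ)) ^ k := by
  have hadd : ∀ (s : Finset (Fin k)) (f : Fin k → ℝ),
      (fourier m ((∑ j ∈ s, f j : ℝ) : UnitAddCircle) : ℂ) =
        ∏ j ∈ s, (fourier m (f j : UnitAddCircle) : ℂ) := by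
    intro s f
    induction s using Finset.induction_on with
    | empty => simp
    | insert i s hi ih =>
      rw [Finset.sum_insert hi, Finset.prod_insert hi, ← ih, AddCircle.coe_add]
      simp only [fourier_apply, smul_add, toCircle_add, Circle.coe_mul]
  simp_rw [hadd]
  rw [← Finset.prod_univ_sum (fun _ : Fin k => Finset.Icc 1 N)
    (fun _ n => (fourier m (x n : UnitAddCircle) : ℂ))]
  simp

theorem sq_weyl_sum_le_sum_kfoldCount {m : ℤ} (hm : m ≠ 0) :
    ∃ ρ₀ : ℝ, 0 < ρ₀ ∧ ∀ (x : ℕ → ℝ) (k N L : ℕ), 0 < N → 0 < L →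
      L / (2 * (N : ℝ) ^ k) < ρ₀ →
      (L : ℝ) ^ 2 + (L : ℝ) ^ 2 / 4 *
        ((‖∑ n ∈ Finset.Icc 1 N, (fourier m (x n : UnitAddCircle) : ℂ)‖ / N) ^ k) ^ 2 ≤
      ∑ l ∈ Finset.Icc 1 L, ((kfoldCount x k N (l / (N : ℝ) ^ k) : ℝ) / (N : ℝ) ^ k + k ^ k) := by
  obtain ⟨ρ₀, h0, h⟩ := exists_sq_norm_sum_fourier_le hm
  refine ⟨ρ₀, h0, fun x k N L hN hL hρ => ?_⟩
  have hM : (0 : ℝ) < (N : ℝ) ^ k := by positivity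
  have hL' : (0 : ℝ) < L := by exact_mod_cast hL
  have key := h _ (by positivity) hρ (Fintype.piFinset (fun _ : Fin k => Finset.Icc 1 N))
    (fun a => ((∑ j, x (a j) : ℝ) : UnitAddCircle))
  rw [sum_piFinset_fourier_eq_pow, norm_pow] at key
  have hcard : ((Fintype.piFinset (fun _ : Fin k => Finset.Icc 1 N)).card : ℝ) = (N : ℝ) ^ k := by
    simp
  rw [hcard] at key
  set M : ℝ := (N : ℝ) ^ k with hMdef
  set S : ℝ := ‖∑ n ∈ Finset.Icc 1 N, (fourier m (x n : UnitAddCircle) : ℂ)‖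
  have hup : ∑ a ∈ Fintype.piFinset (fun _ : Fin k => Finset.Icc 1 N),
      ∑ b ∈ Fintype.piFinset (fun _ : Fin k => Finset.Icc 1 N),
        max 0 (2 * (L / (2 * M)) - ‖((∑ j, x (a j) : ℝ) : UnitAddCircle) -
          ((∑ j, x (b j) : ℝ) : UnitAddCircle)‖) ≤
      (1 / M) * ∑ l ∈ Finset.Icc 1 L, ((kfoldCount x k N (l / M) : ℝ) + k ^ k * M) := by
    calc _ ≤ ∑ a ∈ Fintype.piFinset (fun _ : Fin k => Finset.Icc 1 N),
          ∑ b ∈ Fintype.piFinset (fun _ : Fin k => Finset.Icc 1 N),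
          (1 / M) * ∑ l ∈ Finset.Icc 1 L,
            if tdist (∑ j, x (a j) - ∑ j, x (b j)) ≤ l / M then (1 : ℝ) else 0 := by
          refine Finset.sum_le_sum fun a _ => Finset.sum_le_sum fun b _ => ?_
          rw [← AddCircle.coe_sub, ← tdist_eq_norm,
            show 2 * (L / (2 * M)) = L / M by field_simp]
          exact max_zero_sub_le_sum_ite (abs_nonneg _) hM L
      _ = (1 / M) * ∑ l ∈ Finset.Icc 1 L,
          ∑ a ∈ Fintype.piFinset (fun _ : Fin k => Finset.Icc 1 N),
          ∑ b ∈ Fintype.piFinset (fun _ : Fin k => Finset.Icc 1 N),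
            if tdist (∑ j, x (a j) - ∑ j, x (b j)) ≤ l / M then (1 : ℝ) else 0 := by
          simp_rw [← Finset.mul_sum]
          congr 1
          rw [Finset.sum_comm (s := Finset.Icc 1 L)]
          refine Finset.sum_congr rfl fun a _ => ?_
          rw [Finset.sum_comm (s := Finset.Icc 1 L)]
      _ ≤ _ := by
          gcongr with l hl
          exact sum_ite_tdist_le x k N (l / M)
  have hfin := key.trans hup
  rw [Finset.mul_sum] at hfin
  calc _ = (L / (2 * M)) ^ 2 * (4 * M ^ 2 + (S ^ k) ^ 2) := by
        rw [div_pow S, ← hMdef]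
        field_simp
        norm_num
    _ ≤ _ := hfin
    _ = _ := Finset.sum_congr rfl fun l _ => by field_simp

theorem tendsto_weyl_sum_of_kfold_poissonian (k : ℕ) (hk : 1 ≤ k) (x : ℕ → ℝ)
    (h : ∀ s : ℝ, 0 < s →
      Tendsto (fun N : ℕ => (kfoldCount x k N (s / (N : ℝ) ^ k) : ℝ) / (N : ℝ) ^ k)
        atTop (nhds (2 * s))) {m : ℤ} (hm : m ≠ 0) :
    Tendsto (fun N : ℕ => (∑ n ∈ Finset.Icc 1 N, (fourier m (x n : UnitAddCircle) : ℂ)) / N)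
      atTop (nhds 0) := by
  obtain ⟨ρ₀, h0, key⟩ := sq_weyl_sum_le_sum_kfoldCount hm
  set w : ℕ → ℝ := fun N =>
    ‖∑ n ∈ Finset.Icc 1 N, (fourier m (x n : UnitAddCircle) : ℂ)‖ / N with hw
  have hw0 : ∀ N, 0 ≤ w N := fun N => by positivity
  have hpow : Tendsto (fun N => (w N ^ k) ^ 2) atTop (nhds 0) := by
    refine tendsto_order.2 ⟨fun c hc => Eventually.of_forall fun N =>
      hc.trans_le (by positivity), fun ε hε => ?_⟩
    obtain ⟨L, hL⟩ := exists_nat_gt (4 * (1 + (k : ℝ) ^ k) / ε)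
    have hLpos : (0 : ℝ) < L := lt_of_le_of_lt (by positivity) hL
    have hlim : Tendsto (fun N : ℕ => ∑ l ∈ Finset.Icc 1 L,
        ((kfoldCount x k N (l / (N : ℝ) ^ k) : ℝ) / (N : ℝ) ^ k + (k : ℝ) ^ k)) atTop
        (nhds (∑ l ∈ Finset.Icc 1 L, (2 * (l : ℝ) + (k : ℝ) ^ k))) := by
      refine tendsto_finsetSum _ fun l hl => (h l ?_).add_const _
      exact_mod_cast (Finset.mem_Icc.1 hl).1
    have hsum : ∑ l ∈ Finset.Icc 1 L, (2 * (l : ℝ) + (k : ℝ) ^ k) =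
        L * (L + 1) + L * (k : ℝ) ^ k := by
      have : ∀ n : ℕ, ∑ l ∈ Finset.Icc 1 n, (2 * (l : ℝ) + (k : ℝ) ^ k) =
          n * (n + 1) + n * (k : ℝ) ^ k := by
        intro n
        induction n with
        | zero => simp
        | succ n ih =>
          rw [Finset.sum_Icc_succ_top (by omega), ih]
          push_cast
          ring
      exact this L
    rw [hsum] at hlim
    have hlt : (L : ℝ) * (L + 1) + L * (k : ℝ) ^ k < L ^ 2 + L ^ 2 / 4 * ε := by
      rw [div_lt_iff₀ hε] at hL
      nlinarith
    have hNk : Tendsto (fun N : ℕ => (L : ℝ) / (2 * (N : ℝ) ^ k)) atTop (nhds 0) :=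
      ((tendsto_pow_atTop (by omega : k ≠ 0)).comp tendsto_natCast_atTop_atTop
        |>.const_mul_atTop two_pos).const_div_atTop _
    filter_upwards [hlim.eventually_lt_const hlt, hNk.eventually_lt_const h0,
      eventually_gt_atTop 0] with N h1 h2 h3
    have h4 := (key x k N L h3 (by exact_mod_cast hLpos) h2).trans_lt h1
    have h5 : (L : ℝ) ^ 2 / 4 * (w N ^ k) ^ 2 < L ^ 2 / 4 * ε := by linarith
    exact lt_of_mul_lt_mul_left h5 (by positivity)
  have hw' : Tendsto w atTop (nhds 0) := by
    have h6 := hpow.rpow_const (p := ((k * 2 : ℕ) : ℝ)⁻¹) (Or.inr (by positivity))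
    rw [Real.zero_rpow (by positivity)] at h6
    refine h6.congr fun N => ?_
    rw [← pow_mul, Real.pow_rpow_inv_natCast (hw0 N) (by omega)]
  rw [tendsto_zero_iff_norm_tendsto_zero]
  simpa [hw] using hw'

theorem tendsto_average_of_weyl (x : ℕ → UnitAddCircle)
    (h : ∀ m : ℤ, m ≠ 0 →
      Tendsto (fun N : ℕ => (∑ n ∈ Finset.Icc 1 N, (fourier m (x n) : ℂ)) / N) atTop (nhds 0))
    (f : C(UnitAddCircle, ℂ)) :
    Tendsto (fun N : ℕ => (∑ n ∈ Finset.Icc 1 N, f (x n)) / N) atTop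
      (nhds (∫ t, f t ∂haarAddCircle)) := by
  have hint : ∀ g : C(UnitAddCircle, ℂ), Integrable g haarAddCircle := fun g =>
    g.continuous.integrable_of_hasCompactSupport (HasCompactSupport.of_compactSpace _)
  have hspan : ∀ p ∈ Submodule.span ℂ (Set.range (@fourier 1)),
      Tendsto (fun N : ℕ => (∑ n ∈ Finset.Icc 1 N, p (x n)) / N) atTop
        (nhds (∫ t, p t ∂haarAddCircle)) := by
    intro p hp
    induction hp using Submodule.span_induction with
    | mem p hp =>
      obtain ⟨m, rfl⟩ := hp
      by_cases hm : m = 0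
      · subst hm
        simp only [fourier_zero, integral_const, probReal_univ, one_smul]
        refine tendsto_const_nhds.congr' ?_
        filter_upwards [eventually_gt_atTop 0] with N hN
        have : (N : ℂ) ≠ 0 := by exact_mod_cast hN.ne'
        simp [this]
      · have h0 : ∫ t : UnitAddCircle, fourier m t ∂haarAddCircle = (0 : ℂ) := by
          have := congrFun (fourierCoeff_fourier (T := 1) m) 0
          rw [fourierCoeff, Pi.single_eq_of_ne (Ne.symm hm)] at this
          simpa using this
        rw [h0]
        exact h m hm
    | zero => simp
    | add p q _ _ hp hq =>
      have := hp.add hq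
      rw [← integral_add (hint p) (hint q)] at this
      refine this.congr fun N => ?_
      rw [← add_div, ← Finset.sum_add_distrib]
      rfl
    | smul c p _ hp =>
      have := hp.const_mul c
      rw [← integral_const_mul] at this
      refine this.congr fun N => ?_
      rw [← mul_div_assoc, Finset.mul_sum]
      rfl
  rw [Metric.tendsto_atTop']
  intro ε hε
  have hf : f ∈ closure (Submodule.span ℂ (Set.range (@fourier 1)) : Set C(UnitAddCircle, ℂ)) := by
    rw [← Submodule.topologicalClosure_coe, span_fourier_closure_eq_top]
    trivial
  obtain ⟨p, hp, hfp⟩ := Metric.mem_closure_iff.1 hf (ε / 4) (by positivity)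
  obtain ⟨N₀, hN₀⟩ := Metric.tendsto_atTop'.1 (hspan p hp) (ε / 4) (by positivity)
  refine ⟨N₀, fun N hN => ?_⟩
  have hNpos : (0 : ℝ) < N := by exact_mod_cast (Nat.zero_le _).trans_lt hN
  have hpt : ∀ t, ‖f t - p t‖ ≤ ε / 4 := fun t => by
    rw [← dist_eq_norm]
    exact (ContinuousMap.dist_apply_le_dist t).trans hfp.le
  have h1 : ‖(∑ n ∈ Finset.Icc 1 N, f (x n)) / N - (∑ n ∈ Finset.Icc 1 N, p (x n)) / N‖
      ≤ ε / 4 := by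
    rw [← sub_div, ← Finset.sum_sub_distrib, norm_div, Complex.norm_natCast, div_le_iff₀ hNpos]
    refine (norm_sum_le_of_le _ fun n _ => hpt (x n)).trans ?_
    simp [mul_comm]
  have h2 : ‖(∫ t, p t ∂haarAddCircle) - ∫ t, f t ∂haarAddCircle‖ ≤ ε / 4 := by
    rw [← integral_sub (hint p) (hint f)]
    refine (norm_integral_le_of_norm_le_const (C := ε / 4)
      (Eventually.of_forall fun t => ?_)).trans ?_
    · rw [norm_sub_rev]; exact hpt t
    · simp
  have h3 := hN₀ N hN
  rw [dist_eq_norm] at h3 ⊢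
  set A := (∑ n ∈ Finset.Icc 1 N, f (x n)) / (N : ℂ)
  set B := (∑ n ∈ Finset.Icc 1 N, p (x n)) / (N : ℂ)
  calc ‖A - ∫ t, f t ∂haarAddCircle‖ = ‖(A - B) + (B - ∫ t, p t ∂haarAddCircle) +
        ((∫ t, p t ∂haarAddCircle) - ∫ t, f t ∂haarAddCircle)‖ := by congr 1; ring
    _ ≤ _ := norm_add₃_le
    _ < ε := by linarith

/-- The uniform probability measure on the points `x 1, …, x (N + 1)`. -/
def empiricalMeasure (x : ℕ → UnitAddCircle) (N : ℕ) : Measure UnitAddCircle :=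
  ((N + 1 : ℕ) : ENNReal)⁻¹ • ∑ n ∈ Finset.Icc 1 (N + 1), Measure.dirac (x n)

instance isProbabilityMeasure_empiricalMeasure (x : ℕ → UnitAddCircle) (N : ℕ) :
    IsProbabilityMeasure (empiricalMeasure x N) := by
  constructor
  rw [empiricalMeasure, Measure.smul_apply, Measure.finsetSum_apply]
  simp only [measure_univ, Finset.sum_const, Nat.card_Icc, smul_eq_mul, nsmul_eq_mul, mul_one,
    Nat.add_sub_cancel]
  exact ENNReal.inv_mul_cancel (by simp) (ENNReal.natCast_ne_top _)

theorem integral_empiricalMeasure (x : ℕ → UnitAddCircle) (N : ℕ) (f : C(UnitAddCircle, ℝ)) :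
    ∫ t, f t ∂empiricalMeasure x N =
      (∑ n ∈ Finset.Icc 1 (N + 1), f (x n)) / ((N + 1 : ℕ) : ℝ) := by
  rw [empiricalMeasure, integral_smul_measure, integral_finsetSum_measure]
  · rw [ENNReal.toReal_inv, ENNReal.toReal_natCast]
    simp [div_eq_inv_mul]
  · intro n _
    exact f.continuous.integrable_of_hasCompactSupport (HasCompactSupport.of_compactSpace _)

theorem empiricalMeasure_real_apply (x : ℕ → UnitAddCircle) (N : ℕ) {E : Set UnitAddCircle}
    (hE : MeasurableSet E) :
    (empiricalMeasure x N).real E =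
      (((Finset.Icc 1 (N + 1)).filter (fun n => x n ∈ E)).card : ℝ) / ((N + 1 : ℕ) : ℝ) := by
  rw [measureReal_def, empiricalMeasure, Measure.smul_apply, Measure.finsetSum_apply]
  simp only [Measure.dirac_apply' _ hE, smul_eq_mul, ENNReal.toReal_mul]
  have : ∑ n ∈ Finset.Icc 1 (N + 1), E.indicator (1 : UnitAddCircle → ENNReal) (x n) =
      (((Finset.Icc 1 (N + 1)).filter (fun n => x n ∈ E)).card : ENNReal) := by
    simp [Set.indicator]
  rw [this, ENNReal.toReal_inv, ENNReal.toReal_natCast, ENNReal.toReal_natCast, div_eq_inv_mul]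

theorem tendsto_card_div_of_weyl (x : ℕ → UnitAddCircle)
    (h : ∀ m : ℤ, m ≠ 0 →
      Tendsto (fun N : ℕ => (∑ n ∈ Finset.Icc 1 N, (fourier m (x n) : ℂ)) / N) atTop (nhds 0))
    {E : Set UnitAddCircle} (hE : MeasurableSet E)
    (hfr : (haarAddCircle : Measure UnitAddCircle) (frontier E) = 0) :
    Tendsto (fun N : ℕ => (((Finset.Icc 1 N).filter (fun n => x n ∈ E)).card : ℝ) / N) atTop
      (nhds ((haarAddCircle : Measure UnitAddCircle).real E)) := by
  rw [← tendsto_add_atTop_iff_nat 1]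
  let ν : ℕ → ProbabilityMeasure UnitAddCircle := fun N => ⟨empiricalMeasure x N, inferInstance⟩
  let μ : ProbabilityMeasure UnitAddCircle := ⟨haarAddCircle, inferInstance⟩
  have hlim : Tendsto ν atTop (nhds μ) := by
    rw [ProbabilityMeasure.tendsto_iff_forall_integral_tendsto]
    intro f
    have hc := tendsto_average_of_weyl x h
      ⟨fun t => (f t : ℂ), Complex.continuous_ofReal.comp f.continuous⟩
    have hr := (Complex.continuous_re.tendsto _).comp hc
    rw [← tendsto_add_atTop_iff_nat 1] at hr
    simp only [ContinuousMap.coe_mk, integral_complex_ofReal, Complex.ofReal_re] at hr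
    refine hr.congr fun N => ?_
    refine Eq.trans ?_ (integral_empiricalMeasure x N f.toContinuousMap).symm
    rw [Function.comp_apply, ← Complex.ofReal_sum, ← Complex.ofReal_natCast,
      ← Complex.ofReal_div, Complex.ofReal_re]
    rfl
  have hm := ProbabilityMeasure.tendsto_measure_of_null_frontier_of_tendsto' hlim hfr
  have hm' := (ENNReal.tendsto_toReal (measure_ne_top _ E)).comp hm
  refine hm'.congr fun N => ?_
  exact empiricalMeasure_real_apply x N hE

theorem UnitAddCircle.haarAddCircle_singleton (t : UnitAddCircle) :
    (haarAddCircle : Measure UnitAddCircle) {t} = 0 := by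
  rw [← Metric.closedBall_zero, UnitAddCircle.haarAddCircle_closedBall]
  simp

theorem UnitAddCircle.coe_mem_image_Ico_iff {a b : ℝ} (ha : 0 ≤ a) (hb : b ≤ 1) (u : ℝ) :
    (u : UnitAddCircle) ∈ ((↑) : ℝ → UnitAddCircle) '' Set.Ico a b ↔
      a ≤ Int.fract u ∧ Int.fract u < b := by
  constructor
  · rintro ⟨s, hs, he⟩
    rw [← AddCircle.coe_fract u] at he
    have := (AddCircle.coe_eq_coe_iff_of_mem_Ico (p := (1 : ℝ)) (a := 0)
      ⟨ha.trans hs.1, by linarith [hs.2]⟩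
      ⟨Int.fract_nonneg u, by linarith [Int.fract_lt_one u]⟩).1 he
    rw [← this]
    exact hs
  · intro hu
    exact ⟨Int.fract u, hu, AddCircle.coe_fract u⟩

theorem UnitAddCircle.isOpen_image_Ioo (a b : ℝ) :
    IsOpen (((↑) : ℝ → UnitAddCircle) '' Set.Ioo a b) :=
  QuotientAddGroup.isOpenMap_coe _ isOpen_Ioo

theorem UnitAddCircle.haarAddCircle_image_Ioo {a b : ℝ} (ha : 0 ≤ a) (hb : b ≤ 1) :
    (haarAddCircle : Measure UnitAddCircle) (((↑) : ℝ → UnitAddCircle) '' Set.Ioo a b) =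
      ENNReal.ofReal (b - a) := by
  rw [← UnitAddCircle.volume_eq_haarAddCircle,
    AddCircle.add_projection_respects_measure 1 0 (UnitAddCircle.isOpen_image_Ioo a b).measurableSet]
  have : ((↑) : ℝ → UnitAddCircle) ⁻¹' (((↑) : ℝ → UnitAddCircle) '' Set.Ioo a b) ∩
      Set.Ioc 0 (0 + 1) = Set.Ioo a b := by
    ext u
    constructor
    · rintro ⟨⟨s, hs, he⟩, hu⟩
      have := (AddCircle.coe_eq_coe_iff_of_mem_Ioc (p := (1 : ℝ)) (a := 0)
        ⟨ha.trans_lt hs.1, by linarith [hs.2]⟩ hu).1 he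
      rwa [← this]
    · intro hu
      exact ⟨⟨u, hu, rfl⟩, ha.trans_lt hu.1, by linarith [hu.2]⟩
  refine (congrArg _ this).trans Real.volume_Ioo

theorem UnitAddCircle.image_Icc_diff_image_Ioo_subset (a b : ℝ) :
    ((↑) : ℝ → UnitAddCircle) '' Set.Icc a b \ ((↑) : ℝ → UnitAddCircle) '' Set.Ioo a b ⊆
      {(a : UnitAddCircle), (b : UnitAddCircle)} := by
  rintro _ ⟨⟨s, hs, rfl⟩, hn⟩
  rcases hs.1.eq_or_lt with rfl | h1
  · exact Or.inl rfl
  rcases hs.2.eq_or_lt with rfl | h2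
  · exact Or.inr rfl
  exact absurd ⟨s, ⟨h1, h2⟩, rfl⟩ hn

theorem UnitAddCircle.haarAddCircle_image_Icc_diff_image_Ioo (a b : ℝ) :
    (haarAddCircle : Measure UnitAddCircle)
      (((↑) : ℝ → UnitAddCircle) '' Set.Icc a b \ ((↑) : ℝ → UnitAddCircle) '' Set.Ioo a b) = 0 :=
  measure_mono_null (UnitAddCircle.image_Icc_diff_image_Ioo_subset a b)
    (measure_union_null (UnitAddCircle.haarAddCircle_singleton _)
      (UnitAddCircle.haarAddCircle_singleton _))

theorem equidistributed_of_weyl (x : ℕ → ℝ)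
    (h : ∀ m : ℤ, m ≠ 0 →
      Tendsto (fun N : ℕ => (∑ n ∈ Finset.Icc 1 N, (fourier m (x n : UnitAddCircle) : ℂ)) / N)
        atTop (nhds 0)) :
    Equidistributed x := by
  intro a b ha hab hb
  set π : ℝ → UnitAddCircle := (↑)
  have hnull := UnitAddCircle.haarAddCircle_image_Icc_diff_image_Ioo a b
  have hopen := UnitAddCircle.isOpen_image_Ioo a b
  have hclosed : IsClosed (π '' Set.Icc a b) :=
    (isCompact_Icc.image (AddCircle.continuous_mk' 1)).isClosed
  have hsub₁ : π '' Set.Ioo a b ⊆ π '' Set.Ico a b := Set.image_mono Set.Ioo_subset_Ico_self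
  have hsub₂ : π '' Set.Ico a b ⊆ π '' Set.Icc a b := Set.image_mono Set.Ico_subset_Icc_self
  have hdiff : π '' Set.Ico a b \ π '' Set.Ioo a b ⊆ {(a : UnitAddCircle), (b : UnitAddCircle)} :=
    (Set.sdiff_subset_sdiff_left hsub₂).trans
      (UnitAddCircle.image_Icc_diff_image_Ioo_subset a b)
  have hmeas : MeasurableSet (π '' Set.Ico a b) := by
    rw [← Set.union_sdiff_cancel hsub₁]
    exact hopen.measurableSet.union ((Set.toFinite _).subset hdiff).measurableSet
  have hfr : (haarAddCircle : Measure UnitAddCircle) (frontier (π '' Set.Ico a b)) = 0 :=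
    measure_mono_null (Set.sdiff_subset_sdiff (closure_minimal hsub₂ hclosed)
      (interior_maximal hsub₁ hopen)) hnull
  have hvol : (haarAddCircle : Measure UnitAddCircle).real (π '' Set.Ico a b) = b - a := by
    rw [measureReal_def, ← measure_eq_measure_of_null_sdiff hsub₁
      (measure_mono_null (Set.sdiff_subset_sdiff_left hsub₂) hnull),
      UnitAddCircle.haarAddCircle_image_Ioo ha hb, ENNReal.toReal_ofReal (by linarith)]
  have key := tendsto_card_div_of_weyl (fun n => (x n : UnitAddCircle)) h hmeas hfr
  rw [hvol] at key
  refine key.congr fun N => ?_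
  simp_rw [← UnitAddCircle.coe_mem_image_Ico_iff ha hb]
  rfl

end

/-- Poissonian correlation of `2k`-fold differences implies equidistribution. -/
theorem kfold_poissonian_implies_equidistribution (k : ℕ) (hk : 1 ≤ k) (x : ℕ → ℝ)
    (h : ∀ s : ℝ, 0 < s →
      Tendsto (fun N : ℕ => (kfoldCount x k N (s / (N : ℝ) ^ k) : ℝ) / (N : ℝ) ^ k)
        atTop (nhds (2 * s))) :
    Equidistributed x := by
  exact equidistributed_of_weyl x fun m hm =>
    tendsto_weyl_sum_of_kfold_poissonian k hk x h hm
end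
end

section
/- Let x_1,...,x_N ∈ T and suppose for some 0 < δ < 1/2 and integer T ≥ 1 that (1/N)#{1 ≤ m ≠ n ≤ N : ‖x_m - x_n‖ < s/N} ≤ (1+δ)·2s for all s ∈ {1,...,T}. Then the discrepancy satisfies D_N ≤ C·(T/N + 1/√T + √δ) for a universal constant C. -/
open Filter
open scoped Classical BigOperators

noncomputable section

/-- number of pairs `1 ≤ m ≠ n ≤ N` with `‖x m - x n‖ < ε` (strict). -/
def pairCountLt (x : ℕ → ℝ) (N : ℕ) (ε : ℝ) : ℕ :=
  ((Finset.Icc 1 N ×ˢ Finset.Icc 1 N).filter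
    (fun p => p.1 ≠ p.2 ∧ tdist (x p.1 - x p.2) < ε)).card

open MeasureTheory intervalIntegral

/-- The `1`-periodic indicator function of the arc `[0, h)`. -/
def arcIndicator (h u : ℝ) : ℝ := if Int.fract u < h then 1 else 0

lemma arcIndicator_nonneg (h u : ℝ) : 0 ≤ arcIndicator h u := by
  unfold arcIndicator; split_ifs <;> norm_num

lemma arcIndicator_le_one (h u : ℝ) : arcIndicator h u ≤ 1 := by
  unfold arcIndicator; split_ifs <;> norm_num

lemma arcIndicator_periodic (h : ℝ) : Function.Periodic (arcIndicator h) 1 := by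
  intro u; simp [arcIndicator]

@[fun_prop]
lemma measurable_arcIndicator (h : ℝ) : Measurable (arcIndicator h) :=
  Measurable.ite (measurableSet_lt measurable_fract measurable_const)
    measurable_const measurable_const

lemma intervalIntegrable_of_measurable_of_bound {f : ℝ → ℝ} (hf : Measurable f) {B : ℝ}
    (hB : ∀ t, |f t| ≤ B) (a b : ℝ) : IntervalIntegrable f volume a b :=
  (intervalIntegrable_const (c := B)).mono_fun' hf.aestronglyMeasurable
    (Filter.Eventually.of_forall hB)

lemma intervalIntegrable_arcIndicator_sub (h x : ℝ) :
    IntervalIntegrable (fun t => arcIndicator h (x - t)) volume 0 1 :=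
  intervalIntegrable_of_measurable_of_bound (B := 1) (by fun_prop)
    (fun t => by rw [abs_of_nonneg (arcIndicator_nonneg _ _)]; exact arcIndicator_le_one _ _) _ _

lemma intervalIntegrable_arcIndicator_mul (h x y : ℝ) :
    IntervalIntegrable (fun t => arcIndicator h (x - t) * arcIndicator h (y - t)) volume 0 1 :=
  intervalIntegrable_of_measurable_of_bound (B := 1) (by fun_prop)
    (fun t => by
      rw [abs_of_nonneg (mul_nonneg (arcIndicator_nonneg _ _) (arcIndicator_nonneg _ _))]
      exact mul_le_one₀ (arcIndicator_le_one _ _) (arcIndicator_nonneg _ _)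
        (arcIndicator_le_one _ _)) _ _

lemma integral_periodic_comp_sub_left {g : ℝ → ℝ} (hg : Function.Periodic g 1) (x : ℝ) :
    ∫ t in (0 : ℝ)..1, g (x - t) = ∫ u in (0 : ℝ)..1, g u := by
  rw [intervalIntegral.integral_comp_sub_left]
  have := hg.intervalIntegral_add_eq (x - 1) 0
  simpa using this

lemma integral_indicator_Ico_le (l r : ℝ) :
    ∫ u in (0 : ℝ)..1, (Set.Ico l r).indicator (fun _ => (1 : ℝ)) u ≤ max (r - l) 0 := by
  rw [intervalIntegral.integral_of_le zero_le_one, integral_indicator_const _ measurableSet_Ico,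
    smul_eq_mul, mul_one, ← Real.volume_real_Ico]
  exact ENNReal.toReal_mono (by simp) (Measure.restrict_apply_le _ _)

lemma integral_arcIndicator {h : ℝ} (h0 : 0 ≤ h) (h1 : h ≤ 1) :
    ∫ u in (0 : ℝ)..1, arcIndicator h u = h := by
  have hEq : ∀ u ∈ Set.Ioo (0 : ℝ) 1,
      arcIndicator h u = (Set.Ioo 0 h).indicator (fun _ => (1 : ℝ)) u := by
    intro u hu
    simp [arcIndicator, Set.indicator_apply, Int.fract_eq_self.2 ⟨hu.1.le, hu.2⟩, hu.1]
  rw [intervalIntegral.integral_of_le zero_le_one, integral_Ioc_eq_integral_Ioo,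
    setIntegral_congr_fun measurableSet_Ioo hEq, integral_indicator_const _ measurableSet_Ioo,
    smul_eq_mul, mul_one, measureReal_restrict_apply measurableSet_Ioo,
    Set.inter_eq_left.2 (Set.Ioo_subset_Ioo_right h1), Real.volume_real_Ioo_of_le h0, sub_zero]

lemma integral_arcIndicator_sub {h : ℝ} (h0 : 0 ≤ h) (h1 : h ≤ 1) (x : ℝ) :
    ∫ t in (0 : ℝ)..1, arcIndicator h (x - t) = h := by
  rw [integral_periodic_comp_sub_left (arcIndicator_periodic h), integral_arcIndicator h0 h1]

/-- Two arcs of length `h ≤ 1 / 4` starting at distance `d` overlap in length at most `h - d`. -/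
lemma integral_arcIndicator_mul_le {h : ℝ} (h4 : h ≤ 1 / 4) (x y : ℝ) :
    ∫ t in (0 : ℝ)..1, arcIndicator h (x - t) * arcIndicator h (y - t)
      ≤ max (h - tdist (x - y)) 0 := by
  set g : ℝ → ℝ := fun u => arcIndicator h (x - y + u) * arcIndicator h u with hgdef
  have hg : Function.Periodic g 1 := by
    intro u
    simp only [hgdef, ← add_assoc, arcIndicator_periodic h _]
  have hgt : ∀ t, arcIndicator h (x - t) * arcIndicator h (y - t) = g (y - t) := by
    intro t
    simp only [hgdef]
    congr 2
    ring
  simp_rw [hgt]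
  rw [integral_periodic_comp_sub_left hg]
  set e := x - y - round (x - y) with he
  have hed : |e| ≤ 1 / 2 := abs_sub_round _
  have heb := abs_le.1 hed
  refine le_trans (integral_mono_on_of_le_Ioo
    (g := (Set.Ico (max 0 (-e)) (min h (h - e))).indicator (fun _ => (1 : ℝ)))
    zero_le_one ?_ ?_ ?_) (le_trans (integral_indicator_Ico_le _ _) ?_)
  · refine intervalIntegrable_of_measurable_of_bound (B := 1) (by fun_prop) (fun t => ?_) _ _
    rw [abs_of_nonneg (mul_nonneg (arcIndicator_nonneg _ _) (arcIndicator_nonneg _ _))]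
    exact mul_le_one₀ (arcIndicator_le_one _ _) (arcIndicator_nonneg _ _)
      (arcIndicator_le_one _ _)
  · refine intervalIntegrable_of_measurable_of_bound (B := 1)
      (measurable_const.indicator measurableSet_Ico) (fun t => ?_) _ _
    rw [Set.indicator_apply]
    split_ifs <;> norm_num
  · intro u hu
    have hu0 : Int.fract u = u := Int.fract_eq_self.2 ⟨hu.1.le, hu.2⟩
    have hshift : Int.fract (x - y + u) = Int.fract (e + u) := by
      rw [show x - y + u = e + u + (round (x - y) : ℤ) by rw [he]; ring, Int.fract_add_intCast]
    simp only [hgdef, arcIndicator, hu0, hshift]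
    by_cases h1 : u < h
    · by_cases h2 : Int.fract (e + u) < h
      · have h3 : 0 ≤ e + u := by
          by_contra! hneg
          have : Int.fract (e + u) = e + u + 1 := by
            rw [← Int.fract_add_one, Int.fract_eq_self]
            constructor <;> linarith [hu.1]
          linarith [hu.1]
        have hfract : Int.fract (e + u) = e + u :=
          Int.fract_eq_self.2 ⟨h3, by linarith⟩
        have hmem : u ∈ Set.Ico (max 0 (-e)) (min h (h - e)) :=
          ⟨max_le hu.1.le (by linarith), lt_min h1 (by linarith)⟩
        simp [h1, h2, hmem]
      · simpa [h2] using Set.indicator_nonneg (fun _ _ => zero_le_one) u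
    · simp [h1]
  · have : tdist (x - y) = |e| := rfl
    rw [this]
    refine max_le_max ?_ le_rfl
    rcases abs_cases e with ⟨h1, h2⟩ | ⟨h1, h2⟩
    · linarith [min_le_right h (h - e), le_max_left 0 (-e)]
    · linarith [min_le_left h (h - e), le_max_right 0 (-e)]

lemma max_sub_zero_le_sum_ite {N : ℕ} (hN : 1 ≤ N) (T : ℕ) {d : ℝ} (hd : 0 ≤ d) :
    max ((T : ℝ) / N - d) 0
      ≤ (1 / N) * ∑ s ∈ Finset.Icc 1 T, (if d < (s : ℝ) / N then (1 : ℝ) else 0) := by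
  have hN0 : (0 : ℝ) < N := by exact_mod_cast hN
  rw [← Finset.sum_filter, Finset.sum_const, nsmul_eq_mul, mul_one]
  refine max_le ?_ (by positivity)
  have hsub : Finset.Icc (⌊N * d⌋₊ + 1) T ⊆
      (Finset.Icc 1 T).filter (fun s : ℕ => d < (s : ℝ) / N) := by
    intro s hs
    rw [Finset.mem_Icc] at hs
    rw [Finset.mem_filter, Finset.mem_Icc]
    refine ⟨⟨by omega, hs.2⟩, ?_⟩
    rw [lt_div_iff₀ hN0, mul_comm]
    exact (Nat.floor_lt (by positivity)).1 hs.1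
  have hcard := Finset.card_le_card hsub
  rw [Nat.card_Icc] at hcard
  have h1 : (T : ℝ) ≤
      ((Finset.Icc 1 T).filter (fun s : ℕ => d < (s : ℝ) / N)).card + ⌊N * d⌋₊ := by
    exact_mod_cast (by omega : T ≤ _ + ⌊N * d⌋₊)
  have h2 : (⌊N * d⌋₊ : ℝ) ≤ N * d := Nat.floor_le (by positivity)
  rw [one_div, inv_mul_eq_div, le_div_iff₀ hN0, sub_mul, div_mul_cancel₀ _ hN0.ne']
  linarith

lemma pairCountLt_eq_sum (x : ℕ → ℝ) (N : ℕ) (ε : ℝ) :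
    (pairCountLt x N ε : ℝ) = ∑ m ∈ Finset.Icc 1 N, ∑ n ∈ Finset.Icc 1 N,
      if m ≠ n ∧ tdist (x m - x n) < ε then (1 : ℝ) else 0 := by
  rw [pairCountLt, Finset.card_filter, Nat.cast_sum, Finset.sum_product]
  simp

/-- The number of `x n` lying in the arc of length `h` starting at `t`. -/
def arcCount (x : ℕ → ℝ) (N : ℕ) (h t : ℝ) : ℝ :=
  ∑ n ∈ Finset.Icc 1 N, arcIndicator h (x n - t)

lemma measurable_arcCount (x : ℕ → ℝ) (N : ℕ) (h : ℝ) : Measurable (arcCount x N h) := by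
  unfold arcCount; fun_prop

lemma arcCount_nonneg (x : ℕ → ℝ) (N : ℕ) (h t : ℝ) : 0 ≤ arcCount x N h t :=
  Finset.sum_nonneg fun _ _ => arcIndicator_nonneg _ _

lemma arcCount_le (x : ℕ → ℝ) (N : ℕ) (h t : ℝ) : arcCount x N h t ≤ N := by
  refine (Finset.sum_le_sum fun _ _ => arcIndicator_le_one _ _).trans ?_
  simp

lemma integral_arcCount (x : ℕ → ℝ) (N : ℕ) {h : ℝ} (h0 : 0 ≤ h) (h1 : h ≤ 1) :
    ∫ t in (0 : ℝ)..1, arcCount x N h t = N * h := by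
  unfold arcCount
  rw [intervalIntegral.integral_finsetSum fun _ _ => intervalIntegrable_arcIndicator_sub _ _]
  simp [integral_arcIndicator_sub h0 h1]

lemma integral_arcCount_sq (x : ℕ → ℝ) (N : ℕ) (h : ℝ) :
    ∫ t in (0 : ℝ)..1, arcCount x N h t ^ 2 = ∑ m ∈ Finset.Icc 1 N, ∑ n ∈ Finset.Icc 1 N,
      ∫ t in (0 : ℝ)..1, arcIndicator h (x m - t) * arcIndicator h (x n - t) := by
  simp_rw [arcCount, sq, Finset.sum_mul_sum]
  rw [intervalIntegral.integral_finsetSum fun m _ => by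
    simpa only [Finset.sum_fn] using IntervalIntegrable.sum (Finset.Icc 1 N) fun n _ =>
      intervalIntegrable_arcIndicator_mul h (x m) (x n)]
  exact Finset.sum_congr rfl fun _ _ => intervalIntegral.integral_finsetSum fun _ _ =>
    intervalIntegrable_arcIndicator_mul _ _ _

lemma integral_arcCount_sq_le (x : ℕ → ℝ) {N T : ℕ} {δ : ℝ} (hN : 1 ≤ N)
    (h4 : (T : ℝ) / N ≤ 1 / 4)
    (hpair : ∀ s : ℕ, s ∈ Finset.Icc 1 T →
      (pairCountLt x N ((s : ℝ) / N) : ℝ) / N ≤ (1 + δ) * (2 * s)) :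
    ∫ t in (0 : ℝ)..1, arcCount x N (T / N) t ^ 2 ≤ T + (1 + δ) * (T * (T + 1)) := by
  have hN0 : (0 : ℝ) < N := by exact_mod_cast hN
  have hterm : ∀ m n : ℕ,
      ∫ t in (0 : ℝ)..1, arcIndicator (T / N) (x m - t) * arcIndicator (T / N) (x n - t)
        ≤ (if m = n then (T : ℝ) / N else 0) + (1 / N) * ∑ s ∈ Finset.Icc 1 T,
          (if m ≠ n ∧ tdist (x m - x n) < (s : ℝ) / N then (1 : ℝ) else 0) := by
    intro m n
    refine (integral_arcIndicator_mul_le h4 _ _).trans ?_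
    by_cases hmn : m = n
    · have hT : (0 : ℝ) ≤ T / N := by positivity
      simp [hmn, tdist, hT]
    · have hd : 0 ≤ tdist (x m - x n) := abs_nonneg _
      simpa [hmn] using max_sub_zero_le_sum_ite hN T hd
  rw [integral_arcCount_sq]
  refine (Finset.sum_le_sum fun m _ => Finset.sum_le_sum fun n _ => hterm m n).trans ?_
  have hdiag : ∑ m ∈ Finset.Icc 1 N, ∑ n ∈ Finset.Icc 1 N,
      (if m = n then (T : ℝ) / N else 0) = T := by
    simp only [Finset.sum_ite_eq, Finset.sum_ite_mem, Finset.inter_self, Finset.sum_const,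
      Nat.card_Icc, nsmul_eq_mul]
    simp only [Nat.add_sub_cancel]
    field_simp
  have hoff : ∑ m ∈ Finset.Icc 1 N, ∑ n ∈ Finset.Icc 1 N, (1 / (N : ℝ)) * ∑ s ∈ Finset.Icc 1 T,
      (if m ≠ n ∧ tdist (x m - x n) < (s : ℝ) / N then (1 : ℝ) else 0)
      = ∑ s ∈ Finset.Icc 1 T, (pairCountLt x N ((s : ℝ) / N) : ℝ) / N := by
    simp_rw [pairCountLt_eq_sum, div_eq_inv_mul, ← Finset.mul_sum, mul_one]
    congr 1
    simp_rw [Finset.sum_comm (s := Finset.Icc 1 N) (t := Finset.Icc 1 T)]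
  have hsum : ∑ s ∈ Finset.Icc 1 T, (1 + δ) * (2 * (s : ℝ)) = (1 + δ) * (T * (T + 1)) := by
    rw [← Finset.mul_sum, ← Finset.mul_sum]
    congr 1
    clear hpair h4 hterm hdiag hoff
    induction T with
    | zero => simp
    | succ k ih => rw [Finset.sum_Icc_succ_top (by omega), mul_add, ih]; push_cast; ring
  simp_rw [Finset.sum_add_distrib]
  rw [hdiag, hoff]
  linarith [Finset.sum_le_sum hpair]

lemma integral_arcCount_sub_sq_le (x : ℕ → ℝ) {N T : ℕ} {δ : ℝ} (hN : 1 ≤ N) (hT : 1 ≤ T)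
    (hδ : δ < 1 / 2) (h4 : (T : ℝ) / N ≤ 1 / 4)
    (hpair : ∀ s : ℕ, s ∈ Finset.Icc 1 T →
      (pairCountLt x N ((s : ℝ) / N) : ℝ) / N ≤ (1 + δ) * (2 * s)) :
    ∫ t in (0 : ℝ)..1, (arcCount x N (T / N) t - T) ^ 2 ≤ (T : ℝ) ^ 2 * (δ + 3 / T) := by
  have hN0 : (0 : ℝ) < N := by exact_mod_cast hN
  have hT0 : (0 : ℝ) < T := by exact_mod_cast hT
  have hsq : IntervalIntegrable (fun t => arcCount x N (T / N) t ^ 2) volume 0 1 :=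
    intervalIntegrable_of_measurable_of_bound (B := (N : ℝ) ^ 2)
      ((measurable_arcCount _ _ _).pow_const 2) (fun t => by
        rw [abs_of_nonneg (sq_nonneg _)]
        exact pow_le_pow_left₀ (arcCount_nonneg _ _ _ _) (arcCount_le _ _ _ _) 2) _ _
  have hlin : IntervalIntegrable (arcCount x N (T / N)) volume 0 1 :=
    intervalIntegrable_of_measurable_of_bound (measurable_arcCount _ _ _) (fun t => by
        rw [abs_of_nonneg (arcCount_nonneg _ _ _ _)]
        exact arcCount_le _ _ _ _) _ _
  have hexp : ∀ t, (arcCount x N (T / N) t - T) ^ 2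
      = arcCount x N (T / N) t ^ 2 - 2 * T * arcCount x N (T / N) t + (T : ℝ) ^ 2 := by
    intro t; ring
  simp_rw [hexp]
  rw [intervalIntegral.integral_add (hsq.sub (hlin.const_mul _)) intervalIntegrable_const,
    intervalIntegral.integral_sub hsq (hlin.const_mul _), intervalIntegral.integral_const_mul,
    integral_arcCount x N (by positivity) (by linarith), mul_div_cancel₀ _ hN0.ne']
  have hmain := integral_arcCount_sq_le x hN h4 hpair
  have : (T : ℝ) ^ 2 * (δ + 3 / T) = T ^ 2 * δ + 3 * T := by field_simp
  simp only [intervalIntegral.integral_const, smul_eq_mul]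
  nlinarith

/-- The number of `1 ≤ n ≤ N` with `x n` in `[a, b)` modulo `1`. -/
def intervalCount (x : ℕ → ℝ) (N : ℕ) (a b : ℝ) : ℕ :=
  ((Finset.Icc 1 N).filter (fun n => a ≤ Int.fract (x n) ∧ Int.fract (x n) < b)).card

lemma intervalCount_le (x : ℕ → ℝ) (N : ℕ) (a b : ℝ) : intervalCount x N a b ≤ N :=
  (Finset.card_filter_le _ _).trans (by simp)

lemma intervalCount_add (x : ℕ → ℝ) (N : ℕ) {a b c : ℝ} (hab : a ≤ b) (hbc : b ≤ c) :
    intervalCount x N a b + intervalCount x N b c = intervalCount x N a c := by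
  unfold intervalCount
  rw [← Finset.card_union_of_disjoint, ← Finset.filter_or]
  · congr 1
    refine Finset.filter_congr fun n _ => ?_
    constructor
    · rintro (⟨h1, h2⟩ | ⟨h1, h2⟩) <;> constructor <;> linarith
    · rintro ⟨h1, h2⟩
      rcases lt_or_ge (Int.fract (x n)) b with h | h
      · exact Or.inl ⟨h1, h⟩
      · exact Or.inr ⟨h, h2⟩
  · rw [Finset.disjoint_filter]
    rintro n _ ⟨_, h1⟩ ⟨h2, _⟩
    linarith

lemma intervalCount_zero_one (x : ℕ → ℝ) (N : ℕ) : intervalCount x N 0 1 = N := by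
  simp [intervalCount, Int.fract_nonneg, Int.fract_lt_one]

lemma arcIndicator_le_of_mem {x a b h : ℝ} (hL : b - a + h ≤ 1)
    (ha : a ≤ Int.fract x) (hb : Int.fract x < b) (t : ℝ) :
    arcIndicator h (x - t) ≤ arcIndicator (b - a + h) (b - t) * arcIndicator h (x - t) := by
  by_cases hu : Int.fract (x - t) < h
  · have hfract : Int.fract (b - t) = b - Int.fract x + Int.fract (x - t) := by
      rw [show b - t = b - Int.fract x + Int.fract (x - t) + ((⌊x - t⌋ - ⌊x⌋ : ℤ) : ℝ) by
        push_cast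
        linarith [Int.fract_add_floor x, Int.fract_add_floor (x - t)],
        Int.fract_add_intCast, Int.fract_eq_self]
      constructor <;> linarith [Int.fract_nonneg (x - t)]
    have hlt : Int.fract (b - t) < b - a + h := by linarith
    simp [arcIndicator, hlt]
  · simp [arcIndicator, hu]

lemma intervalIntegrable_arcIndicator_mul_arcCount (x : ℕ → ℝ) (N : ℕ) (L b h : ℝ) :
    IntervalIntegrable (fun t => arcIndicator L (b - t) * arcCount x N h t) volume 0 1 :=
  intervalIntegrable_of_measurable_of_bound (B := N)
    (Measurable.mul (by fun_prop) (measurable_arcCount _ _ _)) (fun t => by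
      rw [Pi.mul_apply,
        abs_of_nonneg (mul_nonneg (arcIndicator_nonneg _ _) (arcCount_nonneg _ _ _ _))]
      exact (mul_le_of_le_one_left (arcCount_nonneg _ _ _ _) (arcIndicator_le_one _ _)).trans
        (arcCount_le _ _ _ _)) _ _

lemma intervalCount_mul_le_integral (x : ℕ → ℝ) (N : ℕ) {a b h : ℝ} (hh : 0 ≤ h) (h1 : h ≤ 1)
    (hL : b - a + h ≤ 1) :
    intervalCount x N a b * h
      ≤ ∫ t in (0 : ℝ)..1, arcIndicator (b - a + h) (b - t) * arcCount x N h t := by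
  set S := (Finset.Icc 1 N).filter (fun n => a ≤ Int.fract (x n) ∧ Int.fract (x n) < b) with hS
  have hint : intervalCount x N a b * h = ∫ t in (0 : ℝ)..1, ∑ n ∈ S, arcIndicator h (x n - t) := by
    rw [intervalIntegral.integral_finsetSum fun _ _ => intervalIntegrable_arcIndicator_sub _ _]
    simp [integral_arcIndicator_sub hh h1, intervalCount, hS]
  rw [hint]
  refine integral_mono_on zero_le_one ?_
    (intervalIntegrable_arcIndicator_mul_arcCount _ _ _ _ _) fun t _ => ?_
  · simpa only [Finset.sum_fn] using IntervalIntegrable.sum S fun n _ =>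
      intervalIntegrable_arcIndicator_sub h (x n)
  · rw [arcCount, Finset.mul_sum]
    refine (Finset.sum_le_sum fun n hn => ?_).trans
      (Finset.sum_le_sum_of_subset_of_nonneg (Finset.filter_subset _ _)
        fun _ _ _ => mul_nonneg (arcIndicator_nonneg _ _) (arcIndicator_nonneg _ _))
    rw [Finset.mem_filter] at hn
    exact arcIndicator_le_of_mem hL hn.2.1 hn.2.2 t

lemma intervalCount_div_le (x : ℕ → ℝ) {N T : ℕ} {δ : ℝ} (hN : 1 ≤ N) (hT : 1 ≤ T)
    (hδ0 : 0 < δ) (hδ : δ < 1 / 2) (h4 : (T : ℝ) / N ≤ 1 / 4)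
    (hpair : ∀ s : ℕ, s ∈ Finset.Icc 1 T →
      (pairCountLt x N ((s : ℝ) / N) : ℝ) / N ≤ (1 + δ) * (2 * s)) {a b : ℝ} (hab : a ≤ b) :
    (intervalCount x N a b : ℝ) / N ≤ b - a + T / N + √(δ + 3 / T) := by
  have hN0 : (0 : ℝ) < N := by exact_mod_cast hN
  have hT0 : (0 : ℝ) < T := by exact_mod_cast hT
  have hh : (0 : ℝ) < T / N := by positivity
  have hV : 0 < δ + 3 / T := by positivity
  set W := √(δ + 3 / T) with hW
  have hW0 : 0 < W := Real.sqrt_pos.2 hV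
  have hWsq : W ^ 2 = δ + 3 / T := Real.sq_sqrt hV.le
  rcases lt_or_ge 1 (b - a + T / N) with hL | hL
  · have : (intervalCount x N a b : ℝ) / N ≤ 1 :=
      div_le_one_of_le₀ (by exact_mod_cast intervalCount_le x N a b) hN0.le
    linarith
  have hvar := integral_arcCount_sub_sq_le x hN hT hδ h4 hpair
  have hsq : IntervalIntegrable (fun t => (arcCount x N (T / N) t - T) ^ 2) volume 0 1 :=
    intervalIntegrable_of_measurable_of_bound (B := (N + T : ℝ) ^ 2)
      (((measurable_arcCount _ _ _).sub_const _).pow_const 2) (fun t => by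
        rw [abs_of_nonneg (sq_nonneg _), sq_le_sq, abs_of_pos (by positivity : (0 : ℝ) < N + T),
          abs_le]
        constructor <;> linarith [arcCount_nonneg x N (T / N) t, arcCount_le x N (T / N) t]) _ _
  set g : ℝ → ℝ := fun t => T * arcIndicator (b - a + T / N) (b - t)
    + 1 / (2 * (T * W)) * (arcCount x N (T / N) t - T) ^ 2 with hg
  have hgint : IntervalIntegrable g volume 0 1 :=
    ((intervalIntegrable_arcIndicator_sub _ _).const_mul _).add (hsq.const_mul _)
  have hle : ∫ t in (0 : ℝ)..1, arcIndicator (b - a + T / N) (b - t) * arcCount x N (T / N) t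
      ≤ ∫ t in (0 : ℝ)..1, (g t + T * W / 2) := by
    refine integral_mono_on zero_le_one (intervalIntegrable_arcIndicator_mul_arcCount _ _ _ _ _)
      (hgint.add intervalIntegrable_const) fun t _ => ?_
    set y := arcCount x N (T / N) t - T with hy
    have hTW : 0 < T * W := by positivity
    have hamgm : y ≤ 1 / (2 * (T * W)) * y ^ 2 + T * W / 2 := by
      have : 1 / (2 * (T * W)) * y ^ 2 + T * W / 2 - y = (y - T * W) ^ 2 / (2 * (T * W)) := by
        field_simp
        ring
      linarith [div_nonneg (sq_nonneg (y - T * W)) (by positivity : 0 ≤ 2 * (T * W))]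
    have hpos : 0 ≤ 1 / (2 * (T * W)) * y ^ 2 + T * W / 2 := by positivity
    have hF : arcCount x N (T / N) t = T + y := by rw [hy]; ring
    rw [hF]
    simp only [hg, ← hy]
    nlinarith [mul_le_mul_of_nonneg_left hamgm (arcIndicator_nonneg (b - a + T / N) (b - t)),
      mul_le_of_le_one_left hpos (arcIndicator_le_one (b - a + T / N) (b - t))]
  have hval : ∫ t in (0 : ℝ)..1, (g t + T * W / 2) ≤ T * (b - a + T / N) + T * W := by
    rw [intervalIntegral.integral_add hgint intervalIntegrable_const, hg,
      intervalIntegral.integral_add ((intervalIntegrable_arcIndicator_sub _ _).const_mul _)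
        (hsq.const_mul _), intervalIntegral.integral_const_mul,
      intervalIntegral.integral_const_mul, integral_arcIndicator_sub (by linarith) hL]
    have h1 := mul_le_mul_of_nonneg_left hvar (by positivity : 0 ≤ 1 / (2 * (T * W)))
    have h2 : 1 / (2 * (T * W)) * ((T : ℝ) ^ 2 * (δ + 3 / T)) = T * W / 2 := by
      rw [← hWsq]
      field_simp
    simp only [intervalIntegral.integral_const, smul_eq_mul]
    linarith
  have hfinal : T * ((intervalCount x N a b : ℝ) / N) ≤ T * (b - a + T / N + W) := by
    calc T * ((intervalCount x N a b : ℝ) / N) = intervalCount x N a b * (T / N) := by ring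
      _ ≤ _ := intervalCount_mul_le_integral x N hh.le (by linarith) hL
      _ ≤ T * (b - a + T / N) + T * W := hle.trans hval
      _ = _ := by ring
  exact le_of_mul_le_mul_left hfinal hT0

/-- If `(1/N)#{m ≠ n : ‖x_m - x_n‖ < s/N} ≤ (1+δ)·2s` for all integers `1 ≤ s ≤ T`,
then the discrepancy satisfies `D_N ≤ C(T/N + 1/√T + √δ)`. -/
theorem discrepancy_bound_from_pair_correlation_delta :
    ∃ C : ℝ, 0 < C ∧
      ∀ (x : ℕ → ℝ) (N T : ℕ) (δ : ℝ), 1 ≤ N → 1 ≤ T → 0 < δ → δ < 1 / 2 →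
        (∀ s : ℕ, s ∈ Finset.Icc 1 T →
          (pairCountLt x N ((s : ℝ) / N) : ℝ) / N ≤ (1 + δ) * (2 * s)) →
        ∀ a b : ℝ, 0 ≤ a → a ≤ b → b ≤ 1 →
          |(((Finset.Icc 1 N).filter
              (fun n => a ≤ Int.fract (x n) ∧ Int.fract (x n) < b)).card : ℝ) / N - (b - a)|
            ≤ C * ((T : ℝ) / N + 1 / Real.sqrt T + Real.sqrt δ) := by
  refine ⟨4, by norm_num, fun x N T δ hN hT hδ0 hδ hpair a b ha hab hb => ?_⟩
  have hN0 : (0 : ℝ) < N := by exact_mod_cast hN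
  have hT0 : (0 : ℝ) < T := by exact_mod_cast hT
  change |(intervalCount x N a b : ℝ) / N - (b - a)| ≤ _
  have hsT : 0 < 1 / √(T : ℝ) := by positivity
  have hsδ : 0 < √δ := Real.sqrt_pos.2 hδ0
  rcases le_or_gt ((T : ℝ) / N) (1 / 4) with h4 | h4
  · have hW : √(δ + 3 / T) ≤ √δ + 2 * (1 / √(T : ℝ)) := by
      refine Real.sqrt_le_iff.2 ⟨by positivity, ?_⟩
      have h1 : √δ ^ 2 = δ := Real.sq_sqrt hδ0.le
      have h2 : (1 / √(T : ℝ)) ^ 2 = 1 / T := by rw [div_pow, Real.sq_sqrt hT0.le, one_pow]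
      have h3 : (3 : ℝ) / T = 3 * (1 / T) := by ring
      rw [h3, ← h2]
      nlinarith [mul_pos hsT hsδ, sq_nonneg (1 / √(T : ℝ))]
    have hupper : ∀ {c d : ℝ}, c ≤ d →
        (intervalCount x N c d : ℝ) / N ≤ d - c + T / N + √(δ + 3 / T) :=
      fun h => intervalCount_div_le x hN hT hδ0 hδ h4 hpair h
    have hsplit : (intervalCount x N 0 a : ℝ) / N + intervalCount x N a b / N
        + intervalCount x N b 1 / N = 1 := by
      rw [← add_div, ← add_div, div_eq_one_iff_eq hN0.ne']
      exact_mod_cast (by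
        rw [intervalCount_add x N ha hab, intervalCount_add x N (ha.trans hab) hb,
          intervalCount_zero_one] :
        intervalCount x N 0 a + intervalCount x N a b + intervalCount x N b 1 = N)
    have hTN : 0 < (T : ℝ) / N := by positivity
    rw [abs_le]
    constructor <;> linarith [hupper ha, hupper hab, hupper hb]
  · have h0 : 0 ≤ (intervalCount x N a b : ℝ) / N := by positivity
    have h1 : (intervalCount x N a b : ℝ) / N ≤ 1 :=
      div_le_one_of_le₀ (by exact_mod_cast intervalCount_le x N a b) hN0.le
    rw [abs_le]
    constructor <;> linarith
end
end

section
/- Let x_1,...,x_N ∈ T, k ≥ 1, α ∈ [0,k], and T > 0 real. Suppose that for all 0 < s < T, (1/N^{2k-α})#{tuples (a_j),(b_j) ∈ [1,N]^k with distinct multisets : ‖Σ x_{a_j} - Σ x_{b_j}‖ ≤ s/N^α} ≤ 2s + F. Then the discrepancy satisfies D_N ≤ C·(T/N^α + k·(k!/(T·N^{k-α}) + F/T)^{1/(2k)}) for a universal constant C. -/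
open Filter
open scoped Classical BigOperators

noncomputable section

/-- The `1`-periodic extension of the second Bernoulli polynomial. -/
def perB2 (y : ℝ) : ℝ := Int.fract y ^ 2 - Int.fract y + 1 / 6

theorem hasSum_perB2 (y : ℝ) :
    HasSum (fun h : ℕ => 1 / (h : ℝ) ^ 2 * Real.cos (2 * Real.pi * h * y))
      (Real.pi ^ 2 * perB2 y) := by
  have h := hasSum_one_div_nat_pow_mul_cos (k := 1) one_ne_zero (x := Int.fract y)
    ⟨Int.fract_nonneg y, (Int.fract_lt_one y).le⟩
  have hB : (Polynomial.map (algebraMap ℚ ℝ) (Polynomial.bernoulli (2 * 1))).eval (Int.fract y)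
      = perB2 y := by
    have : bernoulli 2 = 1 / 6 := by
      rw [bernoulli_eq_bernoulli'_of_ne_one (by norm_num), bernoulli'_two]
    simp [Polynomial.bernoulli, Finset.sum_range_succ, perB2, this]
    ring
  rw [hB] at h
  convert h using 1
  · funext n
    congr 1
    have : 2 * Real.pi * n * y = 2 * Real.pi * n * Int.fract y
        + ((n * ⌊y⌋ : ℤ) : ℝ) * (2 * Real.pi) := by
      conv_lhs => rw [← Int.floor_add_fract y]
      push_cast
      ring
    rw [this, Real.cos_add_int_mul_two_pi]
  · have hf : (((2 * 1).factorial : ℕ) : ℝ) = 2 := by norm_num [Nat.factorial]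
    rw [hf]
    ring

theorem fract_sub_eq_or (y d : ℝ) (hd0 : 0 ≤ d) (hd1 : d ≤ 1) :
    (d ≤ Int.fract y ∧ Int.fract (y - d) = Int.fract y - d) ∨
      (Int.fract y < d ∧ Int.fract (y - d) = Int.fract y - d + 1) := by
  have h0 := Int.fract_nonneg y
  have h1 := Int.fract_lt_one y
  have h2 := Int.self_sub_floor y
  rcases le_or_gt d (Int.fract y) with h | h
  · exact .inl ⟨h, Int.fract_eq_iff.2 ⟨by linarith, by linarith, ⌊y⌋, by linarith⟩⟩
  · exact .inr ⟨h, Int.fract_eq_iff.2 ⟨by linarith, by linarith, ⌊y⌋ - 1, by push_cast; linarith⟩⟩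

theorem fract_add_eq_or (y d : ℝ) (hd0 : 0 ≤ d) (hd1 : d ≤ 1) :
    (Int.fract y + d < 1 ∧ Int.fract (y + d) = Int.fract y + d) ∨
      (1 ≤ Int.fract y + d ∧ Int.fract (y + d) = Int.fract y + d - 1) := by
  have h0 := Int.fract_nonneg y
  have h1 := Int.fract_lt_one y
  have h2 := Int.self_sub_floor y
  rcases lt_or_ge (Int.fract y + d) 1 with h | h
  · exact .inl ⟨h, Int.fract_eq_iff.2 ⟨by linarith, by linarith, ⌊y⌋, by linarith⟩⟩
  · exact .inr ⟨h, Int.fract_eq_iff.2 ⟨by linarith, by linarith, ⌊y⌋ + 1, by push_cast; linarith⟩⟩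

theorem perB2_second_difference_le (y δ : ℝ) (hδ : 0 ≤ δ) (hδ' : δ ≤ 1 / 2) :
    δ ^ 2 + perB2 y - (perB2 (y + δ) + perB2 (y - δ)) / 2 ≤ max 0 (δ - tdist y) := by
  unfold tdist perB2
  rw [abs_sub_round_eq_min]
  have m1 := min_le_left (Int.fract y) (1 - Int.fract y)
  have m2 := min_le_right (Int.fract y) (1 - Int.fract y)
  have l1 := le_max_left 0 (δ - min (Int.fract y) (1 - Int.fract y))
  have l2 := le_max_right 0 (δ - min (Int.fract y) (1 - Int.fract y))
  rcases fract_sub_eq_or y δ hδ (by linarith) with ⟨h1, h2⟩ | ⟨h1, h2⟩ <;>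
  rcases fract_add_eq_or y δ hδ (by linarith) with ⟨h3, h4⟩ | ⟨h3, h4⟩ <;>
  rw [h2, h4] <;> nlinarith

theorem fract_le_perB2_difference (y δ : ℝ) (hδ : 0 < δ) (hδ' : δ ≤ 1) :
    2 * δ * (Int.fract y - 1 / 2) ≤ perB2 y - perB2 (y - δ) + δ ^ 2 := by
  unfold perB2
  have h0 := Int.fract_nonneg y
  rcases fract_sub_eq_or y δ hδ.le hδ' with ⟨h1, h2⟩ | ⟨h1, h2⟩ <;> rw [h2] <;> nlinarith

theorem perB2_difference_le_fract (y δ : ℝ) (hδ : 0 < δ) (hδ' : δ ≤ 1) :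
    perB2 (y + δ) - perB2 y - δ ^ 2 ≤ 2 * δ * (Int.fract y - 1 / 2) := by
  unfold perB2
  have h0 := Int.fract_nonneg y
  have h5 := Int.fract_lt_one y
  rcases fract_add_eq_or y δ hδ.le hδ' with ⟨h1, h2⟩ | ⟨h1, h2⟩ <;> rw [h2] <;> nlinarith

theorem indicator_sub_length_eq (x a b : ℝ) (ha : 0 ≤ a) (hab : a ≤ b) (hb : b ≤ 1) :
    (if a ≤ Int.fract x ∧ Int.fract x < b then (1 : ℝ) else 0) - (b - a)
      = Int.fract (x - b) - Int.fract (x - a) := by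
  rcases fract_sub_eq_or x a ha (by linarith) with ⟨h1, h2⟩ | ⟨h1, h2⟩ <;>
  rcases fract_sub_eq_or x b (by linarith) hb with ⟨h3, h4⟩ | ⟨h3, h4⟩ <;>
  rw [h2, h4] <;> split_ifs with h <;>
  first
  | linarith
  | exact absurd ⟨h1, h3⟩ h

theorem expSum_norm_sq_pow (x : ℕ → ℝ) (k N : ℕ) (t : ℝ) :
    ∑ p ∈ (Fintype.piFinset fun _ : Fin k => Finset.Icc 1 N) ×ˢ
        (Fintype.piFinset fun _ : Fin k => Finset.Icc 1 N),
      Real.cos (t * (∑ j, x (p.1 j) - ∑ j, x (p.2 j)))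
    = ‖∑ n ∈ Finset.Icc 1 N, Complex.exp ((t * x n : ℝ) * Complex.I)‖ ^ (2 * k) := by
  set Z := ∑ n ∈ Finset.Icc 1 N, Complex.exp ((t * x n : ℝ) * Complex.I) with hZ
  have hpow : ∑ a ∈ Fintype.piFinset (fun _ : Fin k => Finset.Icc 1 N),
      Complex.exp ((t * ∑ j, x (a j) : ℝ) * Complex.I) = Z ^ k := by
    have := Finset.prod_univ_sum (fun _ : Fin k => Finset.Icc 1 N)
      (fun _ n => Complex.exp ((t * x n : ℝ) * Complex.I))
    rw [Finset.prod_const, Finset.card_univ, Fintype.card_fin] at this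
    rw [hZ, this]
    refine Finset.sum_congr rfl fun a _ => ?_
    rw [← Complex.exp_sum]
    congr 1
    rw [Finset.mul_sum, Complex.ofReal_sum, Finset.sum_mul]
  have hsq : ‖Z‖ ^ (2 * k) = (Z ^ k * (starRingEnd ℂ) (Z ^ k)).re := by
    rw [Complex.mul_conj, Complex.ofReal_re, Complex.normSq_eq_norm_sq, norm_pow, ← pow_mul,
      mul_comm]
  rw [hsq, ← hpow, map_sum, Finset.sum_mul_sum, ← Finset.sum_product', Complex.re_sum]
  refine Finset.sum_congr rfl fun p _ => ?_
  rw [← Complex.exp_conj, ← Complex.exp_add, map_mul, Complex.conj_ofReal, Complex.conj_I,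
    mul_neg, ← sub_eq_add_neg, ← sub_mul, ← Complex.ofReal_sub, Complex.exp_ofReal_mul_I_re,
    mul_sub]

theorem abs_sum_sin_le (x : ℕ → ℝ) (N : ℕ) (t c : ℝ) :
    |∑ n ∈ Finset.Icc 1 N, Real.sin (t * (x n - c))|
      ≤ ‖∑ n ∈ Finset.Icc 1 N, Complex.exp ((t * x n : ℝ) * Complex.I)‖ := by
  have : ∑ n ∈ Finset.Icc 1 N, Real.sin (t * (x n - c))
      = ((∑ n ∈ Finset.Icc 1 N, Complex.exp ((t * x n : ℝ) * Complex.I))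
        * Complex.exp ((-(t * c) : ℝ) * Complex.I)).im := by
    rw [Finset.sum_mul, Complex.im_sum]
    refine Finset.sum_congr rfl fun n _ => ?_
    rw [← Complex.exp_add, ← add_mul, ← Complex.ofReal_add, Complex.exp_ofReal_mul_I_im]
    ring_nf
  rw [this]
  refine (Complex.abs_im_le_norm _).trans ?_
  rw [norm_mul, Complex.norm_exp_ofReal_mul_I, mul_one]

theorem card_equal_multisets_le (k N : ℕ) :
    (((Fintype.piFinset fun _ : Fin k => Finset.Icc 1 N) ×ˢ
      (Fintype.piFinset fun _ : Fin k => Finset.Icc 1 N)).filter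
    (fun p => (↑(List.ofFn p.1) : Multiset ℕ) = ↑(List.ofFn p.2))).card ≤ k.factorial * N ^ k := by
  have hA : (Fintype.piFinset fun _ : Fin k => Finset.Icc 1 N).card = N ^ k := by
    simp
  rw [Finset.card_filter, Finset.sum_product, ← hA, mul_comm, ← smul_eq_mul]
  refine Finset.sum_le_card_nsmul _ _ _ fun a _ => ?_
  rw [← Finset.card_filter]
  refine (Finset.card_le_card_of_injOn (t := (List.ofFn a).permutations.toFinset)
    (fun b => List.ofFn b) ?_ ?_).trans ((List.toFinset_card_le _).trans ?_)
  · intro b hb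
    rw [Finset.mem_coe, Finset.mem_filter] at hb
    have := Multiset.coe_eq_coe.1 hb.2
    simpa using this.symm
  · exact fun _ _ _ _ h => List.ofFn_injective h
  · rw [List.length_permutations, List.length_ofFn]

theorem inv_rpow_le_telescope (r t : ℝ) (hr : 0 < r) (hr1 : r ≤ 1) (ht : 1 ≤ t) :
    r * (1 / (t + 1)) ^ (1 + r) ≤ (1 / t) ^ r - (1 / (t + 1)) ^ r := by
  have ht0 : 0 < t := by linarith
  set y := (t / (t + 1)) ^ r with hy
  have hypos : 0 < y := by positivity
  set u := (1 / t) ^ r with hu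
  have hupos : 0 < u := by positivity
  have h1 : (1 / (t + 1)) ^ r = u * y := by
    rw [hu, hy, ← Real.mul_rpow (by positivity) (by positivity)]
    congr 1
    field_simp
  have h2 : y ≤ 1 - r * (1 / (t + 1)) := by
    have hs : (-1 : ℝ) ≤ -(1 / (t + 1)) := by
      rw [neg_le_neg_iff, div_le_one (by linarith)]
      linarith
    have := rpow_one_add_le_one_add_mul_self hs hr.le hr1
    rw [show 1 + -(1 / (t + 1)) = t / (t + 1) by field_simp; ring] at this
    linarith
  rw [Real.rpow_add (by positivity), Real.rpow_one, h1]
  have h3 : 0 < r * (1 / (t + 1)) := by positivity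
  nlinarith [mul_nonneg hupos.le (show 0 ≤ 1 - y - r * (1 / (t + 1)) * y by nlinarith)]

theorem sum_inv_rpow_le (r : ℝ) (hr : 0 < r) (hr1 : r ≤ 1) (s : Finset ℕ) :
    ∑ h ∈ s, (1 / (h : ℝ)) ^ (1 + r) ≤ (1 + r) / r := by
  have key : ∀ H : ℕ, ∑ h ∈ Finset.range (H + 2), r * (1 / (h : ℝ)) ^ (1 + r)
      ≤ (1 + r) - (1 / ((H : ℝ) + 1)) ^ r := by
    intro H
    induction H with
    | zero =>
      have : (0 : ℝ) ^ (1 + r) = 0 := Real.zero_rpow (by linarith)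
      simp [Finset.sum_range_succ, this]
    | succ H ih =>
      rw [Finset.sum_range_succ]
      have h0 : (0 : ℝ) ≤ H := H.cast_nonneg
      have := inv_rpow_le_telescope r (H + 1) hr hr1 (by linarith)
      push_cast
      rw [show (H : ℝ) + 2 = H + 1 + 1 by ring]
      linarith
  obtain ⟨H, hH⟩ := s.exists_nat_subset_range
  have hsub : s ⊆ Finset.range (H + 2) := hH.trans (Finset.range_mono (by omega))
  have hle := Finset.sum_le_sum_of_subset_of_nonneg hsub
    (f := fun h : ℕ => (1 / (h : ℝ)) ^ (1 + r)) (fun _ _ _ => by positivity)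
  refine hle.trans ?_
  rw [le_div_iff₀ hr, mul_comm, Finset.mul_sum]
  have : 0 ≤ (1 / ((H : ℝ) + 1)) ^ r := by positivity
  linarith [key H]

theorem weighted_sum_le (k : ℕ) (hk : 1 ≤ k) (σ w : ℕ → ℝ) (E : ℝ)
    (hσ : ∀ h, 0 ≤ σ h) (hσ1 : ∀ h, σ h ≤ 1) (hw : ∀ h, 0 ≤ w h) (s : Finset ℕ)
    (hE : ∑ h ∈ s, σ h ^ 2 * w h ^ (2 * k) ≤ E) :
    ∑ h ∈ s, σ h * w h * (1 / (h : ℝ)) ≤ 2 * k * E ^ ((1 : ℝ) / (2 * k)) := by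
  have hk' : (1 : ℝ) ≤ k := by exact_mod_cast hk
  set p : ℝ := 2 * k with hp
  have hp2 : 2 ≤ p := by linarith
  set r : ℝ := 1 / (p - 1) with hr
  have hr0 : 0 < r := one_div_pos.2 (by linarith)
  have hr1 : r ≤ 1 := by rw [hr, div_le_one (by linarith)]; linarith
  have hpq : p.HolderConjugate (1 + r) := by
    have := Real.HolderConjugate.conjExponent (p := p) (by linarith)
    convert this using 1
    rw [Real.conjExponent, hr]
    have : p - 1 ≠ 0 := by linarith
    field_simp
    ring
  have hterm : ∀ h, 0 ≤ σ h ^ 2 * w h ^ (2 * k) := fun h =>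
    mul_nonneg (sq_nonneg _) (pow_nonneg (hw h) _)
  have hpt : ∀ h, σ h * w h ≤ (σ h ^ 2 * w h ^ (2 * k)) ^ (1 / p) := by
    intro h
    have h1 : σ h * w h = ((σ h * w h) ^ (2 * k)) ^ (1 / p) := by
      have := Real.pow_rpow_inv_natCast (mul_nonneg (hσ h) (hw h)) (n := 2 * k) (by omega)
      rw [one_div, hp]
      push_cast at this
      exact this.symm
    rw [h1]
    refine Real.rpow_le_rpow (pow_nonneg (mul_nonneg (hσ h) (hw h)) _) ?_ (by positivity)
    rw [mul_pow]
    exact mul_le_mul_of_nonneg_right (pow_le_pow_of_le_one (hσ h) (hσ1 h) (by omega))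
      (pow_nonneg (hw h) _)
  have hH := Real.inner_le_Lp_mul_Lq_of_nonneg s (p := p) (q := 1 + r)
    (f := fun h => (σ h ^ 2 * w h ^ (2 * k)) ^ (1 / p)) (g := fun h : ℕ => 1 / (h : ℝ)) hpq
    (fun h _ => Real.rpow_nonneg (hterm h) _) (fun _ _ => by positivity)
  have hfp : ∀ h, ((σ h ^ 2 * w h ^ (2 * k)) ^ (1 / p)) ^ p = σ h ^ 2 * w h ^ (2 * k) := by
    intro h
    rw [← Real.rpow_mul (hterm h), one_div_mul_cancel (by linarith), Real.rpow_one]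
  simp only [hfp] at hH
  have hB : (∑ h ∈ s, (1 / (h : ℝ)) ^ (1 + r)) ^ (1 / (1 + r)) ≤ p := by
    have hs := sum_inv_rpow_le r hr0 hr1 s
    have hpr : (1 + r) / r = p := by
      rw [hr]
      have : p - 1 ≠ 0 := by linarith
      field_simp
      ring
    rw [hpr] at hs
    calc _ ≤ p ^ (1 / (1 + r)) :=
          Real.rpow_le_rpow (Finset.sum_nonneg fun _ _ => by positivity) hs (by positivity)
      _ ≤ p ^ (1 : ℝ) := Real.rpow_le_rpow_of_exponent_le (by linarith)
          ((div_le_one (by linarith)).2 (by linarith))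
      _ = p := Real.rpow_one p
  have hE0 := (Finset.sum_nonneg (fun h (_ : h ∈ s) => hterm h)).trans hE
  calc ∑ h ∈ s, σ h * w h * (1 / (h : ℝ))
      ≤ ∑ h ∈ s, (σ h ^ 2 * w h ^ (2 * k)) ^ (1 / p) * (1 / (h : ℝ)) :=
        Finset.sum_le_sum fun h _ => mul_le_mul_of_nonneg_right (hpt h) (by positivity)
    _ ≤ _ := hH
    _ ≤ E ^ (1 / p) * p := by
        gcongr
        exact Finset.sum_nonneg fun h _ => hterm h
    _ = p * E ^ (1 / p) := mul_comm _ _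

theorem energy_le (x : ℕ → ℝ) (k N : ℕ) (δ R : ℝ) (hδ : 0 ≤ δ) (hδ' : δ ≤ 1 / 2)
    (hR : ∑ p ∈ (Fintype.piFinset fun _ : Fin k => Finset.Icc 1 N) ×ˢ
        (Fintype.piFinset fun _ : Fin k => Finset.Icc 1 N),
      max 0 (δ - tdist (∑ j, x (p.1 j) - ∑ j, x (p.2 j))) ≤ (N : ℝ) ^ (2 * k) * δ ^ 2 + R)
    (s : Finset ℕ) :
    ∑ h ∈ s, 1 / (h : ℝ) ^ 2 * (2 * Real.sin (Real.pi * h * δ) ^ 2) *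
      ‖∑ n ∈ Finset.Icc 1 N, Complex.exp ((2 * Real.pi * h * x n : ℝ) * Complex.I)‖ ^ (2 * k)
      ≤ Real.pi ^ 2 * R := by
  set A := (Fintype.piFinset fun _ : Fin k => Finset.Icc 1 N) ×ˢ
        (Fintype.piFinset fun _ : Fin k => Finset.Icc 1 N) with hA
  have hcard : (A.card : ℝ) = (N : ℝ) ^ (2 * k) := by
    simp [hA, two_mul, pow_add]
  set y : (Fin k → ℕ) × (Fin k → ℕ) → ℝ := fun p => ∑ j, x (p.1 j) - ∑ j, x (p.2 j) with hy
  have hsum := hasSum_sum (s := A) (fun p _ =>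
    (hasSum_perB2 (y p)).sub
      (((hasSum_perB2 (y p + δ)).add (hasSum_perB2 (y p - δ))).div_const 2))
  have hle : ∑ p ∈ A, (Real.pi ^ 2 * perB2 (y p)
      - (Real.pi ^ 2 * perB2 (y p + δ) + Real.pi ^ 2 * perB2 (y p - δ)) / 2)
      ≤ Real.pi ^ 2 * R := by
    have h1 : ∑ p ∈ A, (δ ^ 2 + perB2 (y p) - (perB2 (y p + δ) + perB2 (y p - δ)) / 2)
        ≤ (N : ℝ) ^ (2 * k) * δ ^ 2 + R :=
      (Finset.sum_le_sum fun p _ => perB2_second_difference_le (y p) δ hδ hδ').trans hR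
    simp only [add_sub_assoc] at h1
    rw [Finset.sum_add_distrib, Finset.sum_const, nsmul_eq_mul, hcard] at h1
    calc _ = Real.pi ^ 2 * ∑ p ∈ A, (perB2 (y p) - (perB2 (y p + δ) + perB2 (y p - δ)) / 2) := by
          rw [Finset.mul_sum]
          exact Finset.sum_congr rfl fun p _ => by ring
      _ ≤ _ := mul_le_mul_of_nonneg_left (by linarith) (by positivity)
  have hfun : ∀ h : ℕ, ∑ p ∈ A, (1 / (h : ℝ) ^ 2 * Real.cos (2 * Real.pi * h * y p)
      - (1 / (h : ℝ) ^ 2 * Real.cos (2 * Real.pi * h * (y p + δ))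
        + 1 / (h : ℝ) ^ 2 * Real.cos (2 * Real.pi * h * (y p - δ))) / 2)
      = 1 / (h : ℝ) ^ 2 * (2 * Real.sin (Real.pi * h * δ) ^ 2) *
      ‖∑ n ∈ Finset.Icc 1 N, Complex.exp ((2 * Real.pi * h * x n : ℝ) * Complex.I)‖ ^ (2 * k) := by
    intro h
    rw [← expSum_norm_sq_pow, Finset.mul_sum]
    have hc : Real.cos (2 * Real.pi * h * δ) = 1 - 2 * Real.sin (Real.pi * h * δ) ^ 2 := by
      rw [← Real.cos_two_mul_eq_one_sub]
      ring_nf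
    have htrig : ∀ u : ℝ, 1 / (h : ℝ) ^ 2 * Real.cos (2 * Real.pi * h * u)
        - (1 / (h : ℝ) ^ 2 * Real.cos (2 * Real.pi * h * (u + δ))
          + 1 / (h : ℝ) ^ 2 * Real.cos (2 * Real.pi * h * (u - δ))) / 2
        = 1 / (h : ℝ) ^ 2 * (2 * Real.sin (Real.pi * h * δ) ^ 2)
          * Real.cos (2 * Real.pi * h * u) := by
      intro u
      rw [mul_add, mul_sub, Real.cos_add, Real.cos_sub, hc]
      ring
    exact Finset.sum_congr rfl fun p _ => htrig (y p)
  have := sum_le_hasSum s (fun h _ => by rw [hfun]; positivity) hsum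
  simp only [hfun] at this
  exact this.trans hle

theorem abs_sum_perB2_difference_le (x : ℕ → ℝ) (N : ℕ) (δ K : ℝ)
    (hK : ∀ s : Finset ℕ, ∑ h ∈ s, 1 / (h : ℝ) ^ 2 * (2 * |Real.sin (Real.pi * h * δ)|) *
      ‖∑ n ∈ Finset.Icc 1 N, Complex.exp ((2 * Real.pi * h * x n : ℝ) * Complex.I)‖
      ≤ Real.pi ^ 2 * K) (c : ℝ) :
    |∑ n ∈ Finset.Icc 1 N, (perB2 (x n - c + δ) - perB2 (x n - c))| ≤ K := by
  have hsum := hasSum_sum (s := Finset.Icc 1 N) (fun n _ =>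
    (hasSum_perB2 (x n - c + δ)).sub (hasSum_perB2 (x n - c)))
  have hbound : ∀ s : Finset ℕ, |∑ h ∈ s, ∑ n ∈ Finset.Icc 1 N,
      (1 / (h : ℝ) ^ 2 * Real.cos (2 * Real.pi * h * (x n - c + δ))
      - 1 / (h : ℝ) ^ 2 * Real.cos (2 * Real.pi * h * (x n - c)))| ≤ Real.pi ^ 2 * K := by
    intro s
    refine (Finset.abs_sum_le_sum_abs _ _).trans ((Finset.sum_le_sum fun h _ => ?_).trans (hK s))
    have : ∑ n ∈ Finset.Icc 1 N,
        (1 / (h : ℝ) ^ 2 * Real.cos (2 * Real.pi * h * (x n - c + δ))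
        - 1 / (h : ℝ) ^ 2 * Real.cos (2 * Real.pi * h * (x n - c)))
        = 1 / (h : ℝ) ^ 2 * (-2 * Real.sin (Real.pi * h * δ)) *
          ∑ n ∈ Finset.Icc 1 N, Real.sin (2 * Real.pi * h * (x n - (c - δ / 2))) := by
      rw [Finset.mul_sum]
      refine Finset.sum_congr rfl fun n _ => ?_
      rw [← mul_sub, Real.cos_sub_cos]
      ring_nf
    rw [this, abs_mul, abs_mul, abs_mul, abs_neg, abs_two, abs_of_nonneg (by positivity :
      (0 : ℝ) ≤ 1 / (h : ℝ) ^ 2)]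
    exact mul_le_mul_of_nonneg_left (abs_sum_sin_le _ _ _ _) (by positivity)
  have hlim := le_of_tendsto hsum.abs (Filter.Eventually.of_forall hbound)
  simp only [← mul_sub] at hlim
  rw [← Finset.mul_sum, abs_mul, abs_of_nonneg (by positivity)] at hlim
  exact le_of_mul_le_mul_left hlim (by positivity)

theorem monotone_step (d : ℝ) : Monotone fun ε : ℝ => if d ≤ ε then (1 : ℝ) else 0 := by
  intro a b hab
  dsimp only
  split_ifs <;> linarith

theorem max_sub_le_integral_step (d δ : ℝ) (hd : 0 ≤ d) (hδ : 0 ≤ δ) :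
    max 0 (δ - d) ≤ ∫ ε in (0 : ℝ)..δ, (if d ≤ ε then (1 : ℝ) else 0) := by
  have hint : ∀ a b : ℝ, IntervalIntegrable (fun ε : ℝ => if d ≤ ε then (1 : ℝ) else 0)
      MeasureTheory.volume a b := fun a b => (monotone_step d).intervalIntegrable
  have hnonneg : ∀ a : ℝ, 0 ≤ a → 0 ≤ ∫ ε in (0 : ℝ)..a, (if d ≤ ε then (1 : ℝ) else 0) :=
    fun a ha => intervalIntegral.integral_nonneg ha fun ε _ => by split_ifs <;> norm_num
  refine max_le (hnonneg δ hδ) ?_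
  rcases le_total δ d with h | h
  · linarith [hnonneg δ hδ]
  · rw [← intervalIntegral.integral_add_adjacent_intervals (hint 0 d) (hint d δ)]
    have : ∫ ε in d..δ, (if d ≤ ε then (1 : ℝ) else 0) = ∫ _ in d..δ, (1 : ℝ) :=
      intervalIntegral.integral_congr fun ε hε => by
        rw [Set.uIcc_of_le h] at hε
        exact if_pos hε.1
    rw [this, intervalIntegral.integral_const, smul_eq_mul, mul_one]
    linarith [hnonneg d hd]

theorem sum_triangle_le {ι : Type*} (A : Finset ι) (d : ι → ℝ) (hd : ∀ p, 0 ≤ d p)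
    (δ U V : ℝ) (hδ : 0 ≤ δ)
    (hcount : ∀ ε, 0 < ε → ε < δ → ((A.filter fun p => d p ≤ ε).card : ℝ) ≤ 2 * U * ε + V) :
    ∑ p ∈ A, max 0 (δ - d p) ≤ U * δ ^ 2 + V * δ := by
  have hint : ∀ p ∈ A, IntervalIntegrable (fun ε : ℝ => if d p ≤ ε then (1 : ℝ) else 0)
      MeasureTheory.volume 0 δ := fun p _ =>
    (monotone_step (d p)).intervalIntegrable
  calc ∑ p ∈ A, max 0 (δ - d p)
      ≤ ∑ p ∈ A, ∫ ε in (0 : ℝ)..δ, (if d p ≤ ε then (1 : ℝ) else 0) :=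
        Finset.sum_le_sum fun p _ => max_sub_le_integral_step _ _ (hd p) hδ
    _ = ∫ ε in (0 : ℝ)..δ, ∑ p ∈ A, (if d p ≤ ε then (1 : ℝ) else 0) :=
        (intervalIntegral.integral_finsetSum hint).symm
    _ ≤ ∫ ε in (0 : ℝ)..δ, (2 * U * ε + V) := by
        refine intervalIntegral.integral_mono_on_of_le_Ioo hδ ?_ ?_ fun ε hε => ?_
        · simpa only [Finset.sum_fn] using IntervalIntegrable.sum A hint
        · exact Continuous.intervalIntegrable (by fun_prop) _ _
        · rw [Finset.sum_boole]
          exact hcount ε hε.1 hε.2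
    _ = U * δ ^ 2 + V * δ := by
        rw [intervalIntegral.integral_add
          (Continuous.intervalIntegrable (by fun_prop) _ _)
          (Continuous.intervalIntegrable (by fun_prop) _ _),
          intervalIntegral.integral_const_mul, integral_id, intervalIntegral.integral_const,
          smul_eq_mul]
        ring

theorem card_close_pairs_le (x : ℕ → ℝ) (k N : ℕ) (ε : ℝ) :
    (((Fintype.piFinset fun _ : Fin k => Finset.Icc 1 N) ×ˢ
      (Fintype.piFinset fun _ : Fin k => Finset.Icc 1 N)).filter
    (fun p => tdist (∑ j, x (p.1 j) - ∑ j, x (p.2 j)) ≤ ε)).card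
      ≤ kfoldCount x k N ε + k.factorial * N ^ k := by
  refine le_trans ?_ (Nat.add_le_add_left (card_equal_multisets_le k N) _)
  unfold kfoldCount
  refine (Finset.card_le_card fun p hp => ?_).trans (Finset.card_union_le _ _)
  rw [Finset.mem_filter] at hp
  rw [Finset.mem_union, Finset.mem_filter, Finset.mem_filter]
  by_cases h : (↑(List.ofFn p.1) : Multiset ℕ) = ↑(List.ofFn p.2)
  · exact .inr ⟨hp.1, h⟩
  · exact .inl ⟨hp.1, h, hp.2⟩

theorem abs_sum_fract_sub_half_le (x : ℕ → ℝ) (N : ℕ) (δ K : ℝ) (hδ : 0 < δ) (hδ' : δ ≤ 1)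
    (hK : ∀ c, |∑ n ∈ Finset.Icc 1 N, (perB2 (x n - c + δ) - perB2 (x n - c))| ≤ 2 * δ * K)
    (b : ℝ) : |∑ n ∈ Finset.Icc 1 N, (Int.fract (x n - b) - 1 / 2)| ≤ K + N * δ / 2 := by
  have hcard : ((Finset.Icc 1 N).card : ℝ) = N := by simp
  have hup : 2 * δ * ∑ n ∈ Finset.Icc 1 N, (Int.fract (x n - b) - 1 / 2)
      ≤ 2 * δ * K + N * δ ^ 2 := by
    have h1 := Finset.sum_le_sum fun n (_ : n ∈ Finset.Icc 1 N) =>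
      fract_le_perB2_difference (x n - b) δ hδ hδ'
    rw [← Finset.mul_sum, Finset.sum_add_distrib, Finset.sum_const, nsmul_eq_mul, hcard] at h1
    have h2 := (abs_le.1 (hK (b + δ))).2
    have h3 : ∀ n, x n - (b + δ) + δ = x n - b ∧ x n - (b + δ) = x n - b - δ :=
      fun n => ⟨by ring, by ring⟩
    simp only [fun n => (h3 n).1] at h2
    simp only [fun n => (h3 n).2] at h2
    linarith
  have hlow : -(2 * δ * K + N * δ ^ 2)
      ≤ 2 * δ * ∑ n ∈ Finset.Icc 1 N, (Int.fract (x n - b) - 1 / 2) := by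
    have h1 := Finset.sum_le_sum fun n (_ : n ∈ Finset.Icc 1 N) =>
      perB2_difference_le_fract (x n - b) δ hδ hδ'
    rw [← Finset.mul_sum, Finset.sum_sub_distrib, Finset.sum_const, nsmul_eq_mul, hcard] at h1
    have h2 := (abs_le.1 (hK b)).1
    linarith
  have h2δ : 0 < 2 * δ := by linarith
  rw [abs_le]
  constructor
  · refine le_of_mul_le_mul_left ?_ h2δ
    linarith
  · refine le_of_mul_le_mul_left ?_ h2δ
    linarith

theorem sum_triangle_of_count_le (x : ℕ → ℝ) (N k : ℕ) (α T F : ℝ) (hN : 1 ≤ N) (hT : 0 < T)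
    (hcorr : ∀ s : ℝ, 0 < s → s < T →
      (kfoldCount x k N (s / (N : ℝ) ^ α) : ℝ) / (N : ℝ) ^ (2 * (k : ℝ) - α) ≤ 2 * s + F) :
    ∑ p ∈ (Fintype.piFinset fun _ : Fin k => Finset.Icc 1 N) ×ˢ
        (Fintype.piFinset fun _ : Fin k => Finset.Icc 1 N),
      max 0 (T / (N : ℝ) ^ α - tdist (∑ j, x (p.1 j) - ∑ j, x (p.2 j)))
      ≤ (N : ℝ) ^ (2 * k) * (T / (N : ℝ) ^ α) ^ 2 + (N : ℝ) ^ (2 * k) *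
        (((k.factorial : ℝ) / (T * (N : ℝ) ^ ((k : ℝ) - α)) + F / T) * (T / (N : ℝ) ^ α) ^ 2) := by
  have hN0 : (0 : ℝ) < N := by exact_mod_cast hN
  set M := (N : ℝ) ^ α with hM
  have hM0 : 0 < M := by positivity
  have h2k : (N : ℝ) ^ (2 * (k : ℝ) - α) = (N : ℝ) ^ (2 * k) / M := by
    rw [Real.rpow_sub hN0, ← Real.rpow_natCast]
    push_cast
    rfl
  have hk : (N : ℝ) ^ ((k : ℝ) - α) = (N : ℝ) ^ k / M := by
    rw [Real.rpow_sub hN0, Real.rpow_natCast]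
  have := sum_triangle_le ((Fintype.piFinset fun _ : Fin k => Finset.Icc 1 N) ×ˢ
        (Fintype.piFinset fun _ : Fin k => Finset.Icc 1 N))
    (fun p => tdist (∑ j, x (p.1 j) - ∑ j, x (p.2 j))) (fun _ => abs_nonneg _) (T / M)
    ((N : ℝ) ^ (2 * k)) ((N : ℝ) ^ (2 * k) * (F / M) + k.factorial * (N : ℝ) ^ k)
    (by positivity) ?_
  · refine this.trans (le_of_eq ?_)
    rw [hk]
    field_simp
    ring
  · intro ε hε hεT
    have h1 := hcorr (ε * M) (by positivity) ((lt_div_iff₀ hM0).1 hεT)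
    rw [mul_div_cancel_right₀ _ hM0.ne', h2k, div_le_iff₀ (by positivity)] at h1
    have h2 : (_ : ℝ) ≤ _ := Nat.cast_le.2 (card_close_pairs_le x k N ε)
    push_cast at h2
    refine h2.trans ?_
    have h3 : (2 * (ε * M) + F) * ((N : ℝ) ^ (2 * k) / M)
        = 2 * (N : ℝ) ^ (2 * k) * ε + (N : ℝ) ^ (2 * k) * (F / M) := by
      field_simp
    linarith

theorem weighted_expSum_le (x : ℕ → ℝ) (N k : ℕ) (δ E : ℝ) (hN : 1 ≤ N) (hk : 1 ≤ k)
    (hδ : 0 < δ)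
    (henergy : ∀ s : Finset ℕ, ∑ h ∈ s, 1 / (h : ℝ) ^ 2 * (2 * Real.sin (Real.pi * h * δ) ^ 2) *
      ‖∑ n ∈ Finset.Icc 1 N, Complex.exp ((2 * Real.pi * h * x n : ℝ) * Complex.I)‖ ^ (2 * k)
      ≤ Real.pi ^ 2 * ((N : ℝ) ^ (2 * k) * (E * δ ^ 2))) (hE : 0 ≤ E) (s : Finset ℕ) :
    ∑ h ∈ s, 1 / (h : ℝ) ^ 2 * (2 * |Real.sin (Real.pi * h * δ)|) *
      ‖∑ n ∈ Finset.Icc 1 N, Complex.exp ((2 * Real.pi * h * x n : ℝ) * Complex.I)‖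
      ≤ Real.pi ^ 2 * (2 * δ * (N * (2 * k * E ^ ((1 : ℝ) / (2 * k))))) := by
  have hN0 : (0 : ℝ) < N := by exact_mod_cast hN
  have hpi := Real.pi_pos
  set Z : ℕ → ℝ := fun h =>
    ‖∑ n ∈ Finset.Icc 1 N, Complex.exp ((2 * Real.pi * h * x n : ℝ) * Complex.I)‖ with hZ
  set σ : ℕ → ℝ := fun h => |Real.sin (Real.pi * h * δ)| / (Real.pi * h * δ) with hσ
  have hσ1 : ∀ h, σ h ≤ 1 := fun h =>
    div_le_one_of_le₀ ((Real.abs_sin_le_abs).trans (abs_of_nonneg (by positivity)).le)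
      (by positivity)
  have hw := weighted_sum_le k hk σ (fun h => Z h / N) E (fun h => by positivity) hσ1
    (fun h => by positivity) s ?_
  · calc _ = ∑ h ∈ s, 2 * Real.pi * δ * N * (σ h * (Z h / N) * (1 / (h : ℝ))) := by
          refine Finset.sum_congr rfl fun h _ => ?_
          rcases eq_or_ne h 0 with rfl | hh
          · simp
          · have : (h : ℝ) ≠ 0 := by exact_mod_cast hh
            change _ * Z h = _
            simp only [hσ]
            field_simp
      _ = 2 * Real.pi * δ * N * ∑ h ∈ s, σ h * (Z h / N) * (1 / (h : ℝ)) := by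
          rw [Finset.mul_sum]
      _ ≤ 2 * Real.pi * δ * N * (2 * k * E ^ ((1 : ℝ) / (2 * k))) := by gcongr
      _ = Real.pi * (2 * δ * (N * (2 * k * E ^ ((1 : ℝ) / (2 * k))))) := by ring
      _ ≤ _ := by
          refine mul_le_mul_of_nonneg_right ?_ (by positivity)
          nlinarith [Real.pi_gt_three]
  · refine le_of_mul_le_mul_left (a := 2 * (Real.pi ^ 2 * ((N : ℝ) ^ (2 * k) * δ ^ 2))) ?_
      (by positivity)
    calc _ = ∑ h ∈ s, 1 / (h : ℝ) ^ 2 * (2 * Real.sin (Real.pi * h * δ) ^ 2) * Z h ^ (2 * k) := by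
          rw [Finset.mul_sum]
          refine Finset.sum_congr rfl fun h _ => ?_
          rcases eq_or_ne h 0 with rfl | hh
          · simp [hσ]
          · have : (h : ℝ) ≠ 0 := by exact_mod_cast hh
            simp only [hσ]
            rw [div_pow, div_pow, sq_abs]
            field_simp
      _ ≤ _ := henergy s
      _ ≤ _ := by
          have : 0 ≤ Real.pi ^ 2 * ((N : ℝ) ^ (2 * k) * (E * δ ^ 2)) := by positivity
          linarith

theorem abs_discrepancy_le_one (x : ℕ → ℝ) (N : ℕ) (a b : ℝ) (ha : 0 ≤ a) (hab : a ≤ b)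
    (hb : b ≤ 1) :
    |(((Finset.Icc 1 N).filter
      (fun n => a ≤ Int.fract (x n) ∧ Int.fract (x n) < b)).card : ℝ) / N - (b - a)| ≤ 1 := by
  have hcard : (((Finset.Icc 1 N).filter
      (fun n => a ≤ Int.fract (x n) ∧ Int.fract (x n) < b)).card : ℝ) ≤ N := by
    exact_mod_cast (Finset.card_filter_le _ _).trans (by simp)
  have h1 := div_le_one_of_le₀ hcard N.cast_nonneg
  have h0 : 0 ≤ (((Finset.Icc 1 N).filter
      (fun n => a ≤ Int.fract (x n) ∧ Int.fract (x n) < b)).card : ℝ) / N := by positivity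
  rw [abs_le]
  constructor <;> linarith

theorem discrepancy_eq_sum_fract (x : ℕ → ℝ) (N : ℕ) (hN : 1 ≤ N) (a b : ℝ) (ha : 0 ≤ a)
    (hab : a ≤ b) (hb : b ≤ 1) :
    (((Finset.Icc 1 N).filter
      (fun n => a ≤ Int.fract (x n) ∧ Int.fract (x n) < b)).card : ℝ) / N - (b - a)
    = (∑ n ∈ Finset.Icc 1 N, (Int.fract (x n - b) - 1 / 2)
      - ∑ n ∈ Finset.Icc 1 N, (Int.fract (x n - a) - 1 / 2)) / N := by
  have hN0 : (N : ℝ) ≠ 0 := by exact_mod_cast (by omega : N ≠ 0)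
  have h := Finset.sum_congr rfl fun n (_ : n ∈ Finset.Icc 1 N) =>
    indicator_sub_length_eq (x n) a b ha hab hb
  rw [Finset.sum_sub_distrib, Finset.sum_boole, Finset.sum_const, nsmul_eq_mul, Nat.card_Icc,
    Nat.add_sub_cancel] at h
  rw [eq_div_iff hN0, sub_mul, div_mul_cancel₀ _ hN0, mul_comm (b - a), h,
    ← Finset.sum_sub_distrib]
  exact Finset.sum_congr rfl fun n _ => by ring

/-- Discrepancy bound from rate-`α` correlation control:
if `(1/N^{2k-α})·#{…: ‖Σ x_{a_j} - Σ x_{b_j}‖ ≤ s/N^α} ≤ 2s + F` for all `0 < s < T`,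
then `D_N ≤ C(T/N^α + k(k!/(T·N^{k-α}) + F/T)^{1/(2k)})`. -/
theorem discrepancy_bound_rate_alpha :
    ∃ C : ℝ, 0 < C ∧
      ∀ (x : ℕ → ℝ) (N k : ℕ) (α T F : ℝ), 1 ≤ N → 1 ≤ k → 0 ≤ α → α ≤ k →
        0 < T → 0 ≤ F →
        (∀ s : ℝ, 0 < s → s < T →
          (kfoldCount x k N (s / (N : ℝ) ^ α) : ℝ) / (N : ℝ) ^ (2 * (k : ℝ) - α) ≤ 2 * s + F) →
        ∀ a b : ℝ, 0 ≤ a → a ≤ b → b ≤ 1 →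
          |(((Finset.Icc 1 N).filter
              (fun n => a ≤ Int.fract (x n) ∧ Int.fract (x n) < b)).card : ℝ) / N - (b - a)|
            ≤ C * (T / (N : ℝ) ^ α + (k : ℝ) *
                ((k.factorial : ℝ) / (T * (N : ℝ) ^ ((k : ℝ) - α)) + F / T) ^ ((1 : ℝ) / (2 * k))) := by
  refine ⟨4, by norm_num, ?_⟩
  intro x N k α T F hN hk _ _ hT hF hcorr a b ha hab hb
  have hN0 : (0 : ℝ) < N := by exact_mod_cast hN
  have htri := sum_triangle_of_count_le x N k α T F hN hT hcorr
  set δ := T / (N : ℝ) ^ α with hδ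
  set E := (k.factorial : ℝ) / (T * (N : ℝ) ^ ((k : ℝ) - α)) + F / T with hE
  have hδ0 : 0 < δ := by positivity
  have hE0 : 0 ≤ E := by positivity
  have hP : 0 ≤ (k : ℝ) * E ^ ((1 : ℝ) / (2 * k)) := by positivity
  rcases le_or_gt δ (1 / 2) with hδ' | hδ'
  · have hfract := abs_sum_fract_sub_half_le x N δ _ hδ0 (by linarith)
      (abs_sum_perB2_difference_le x N δ _
        (weighted_expSum_le x N k δ E hN hk hδ0 (energy_le x k N δ _ hδ0.le hδ' htri) hE0))
    rw [discrepancy_eq_sum_fract x N hN a b ha hab hb, abs_div, abs_of_pos hN0, div_le_iff₀ hN0]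
    refine (abs_sub _ _).trans ((add_le_add (hfract b) (hfract a)).trans ?_)
    nlinarith [mul_pos hN0 hδ0]
  · exact (abs_discrepancy_le_one x N a b ha hab hb).trans (by linarith)
end
end
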